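/- Let V = ⊕_{k=1}^r V_{d_k} be a representation of SL(2,ℂ) with all d_k ≥ 1, and assume V is not isomorphic to 2V₁ nor to V_d for any d ≤ 4. Then the a-invariant of ℂ[V]^{SL₂}, i.e. the degree of the rational function Hilb_V(t) (degree of numerator minus degree of denominator), equals −D. -/

import Mathlib

open scoped BigOperators

noncomputable section

/-- The binary form of degree `n` with coefficient vector `v`, as a polynomial in two variables. -/
def binForm (n : ℕ) (v : Fin (n + 1) → ℂ) : MvPolynomial (Fin 2) ℂ :=
  ∑ i : Fin (n + 1),
    MvPolynomial.C (v i) * MvPolynomial.X 0 ^ (i : ℕ) * MvPolynomial.X 1 ^ (n - (i : ℕ))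

/-- The action of `g ∈ SL(2,ℂ)` on coefficient vectors of binary forms of degree `n`,
given by linear substitution in the two variables. -/
def binFormAct (n : ℕ) (g : Matrix.SpecialLinearGroup (Fin 2) ℂ)
    (v : Fin (n + 1) → ℂ) : Fin (n + 1) → ℂ := fun i =>
  MvPolynomial.coeff (Finsupp.single 0 (i : ℕ) + Finsupp.single 1 (n - (i : ℕ)))
    (MvPolynomial.aeval
      (fun j : Fin 2 => ∑ l : Fin 2,
        MvPolynomial.C ((g : Matrix (Fin 2) (Fin 2) ℂ) j l) * MvPolynomial.X l)
      (binForm n v))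

/-- The `SL(2,ℂ)`-action on `V = ⊕ₖ V_{d k}`, in coordinates. -/
def repAct (r : ℕ) (d : Fin r → ℕ) (g : Matrix.SpecialLinearGroup (Fin 2) ℂ)
    (v : (Σ k : Fin r, Fin (d k + 1)) → ℂ) : (Σ k : Fin r, Fin (d k + 1)) → ℂ :=
  fun p => binFormAct (d p.1) g (fun i => v ⟨p.1, i⟩) p.2

/-- The space of `SL(2,ℂ)`-invariant polynomial functions on `V` that are homogeneous of
degree `n`. -/
def invariantsDeg (r : ℕ) (d : Fin r → ℕ) (n : ℕ) :
    Submodule ℂ (MvPolynomial (Σ k : Fin r, Fin (d k + 1)) ℂ) :=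
  MvPolynomial.homogeneousSubmodule _ ℂ n ⊓
    ⨅ (g : Matrix.SpecialLinearGroup (Fin 2) ℂ)
      (v : (Σ k : Fin r, Fin (d k + 1)) → ℂ),
        LinearMap.ker ((MvPolynomial.aeval (R := ℂ) (repAct r d g v)).toLinearMap
          - (MvPolynomial.aeval (R := ℂ) v).toLinearMap)

/-- `dim_ℂ (ℂ[V]^{SL₂})_n`. -/
def hilbDim (r : ℕ) (d : Fin r → ℕ) (n : ℕ) : ℕ :=
  Module.finrank ℂ (invariantsDeg r d n)

/-- The Hilbert series of `ℂ[V]^{SL₂}` as a function of a real variable `t`. -/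
def hilbFun (r : ℕ) (d : Fin r → ℕ) (t : ℝ) : ℝ :=
  ∑' n : ℕ, (hilbDim r d n : ℝ) * t ^ n

namespace SL2Hilbert
section Reciprocity
open Polynomial

/-- Admissible denominators. -/
def IsDenom (g : ℝ[X]) : Prop :=
  g.eval 0 = 1 ∧ ∀ t : ℝ, 0 < t → t ≠ 1 → g.eval t ≠ 0

lemma IsDenom.one : IsDenom 1 := ⟨by simp, fun t _ _ => by simp⟩

lemma IsDenom.mul {f g : ℝ[X]} (hf : IsDenom f) (hg : IsDenom g) : IsDenom (f * g) :=
  ⟨by simp [hf.1, hg.1], fun t h0 h1 => by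
    simpa using ⟨hf.2 t h0 h1, hg.2 t h0 h1⟩⟩

lemma IsDenom.one_sub_X_pow {n : ℕ} (hn : n ≠ 0) : IsDenom (1 - X ^ n) := by
  refine ⟨by simp [hn], fun t h0 h1 h => h1 ?_⟩
  have h2 : t ^ n = 1 := by
    simp only [eval_sub, eval_one, eval_pow, eval_X] at h
    linarith
  exact (pow_eq_one_iff_of_nonneg h0.le hn).1 h2

lemma IsDenom.pow {f : ℝ[X]} (hf : IsDenom f) (n : ℕ) : IsDenom (f ^ n) := by
  induction n with
  | zero => simpa using IsDenom.one
  | succ n ih => rw [pow_succ]; exact ih.mul hf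

/-- `p` and `q` generate an ideal that contains an admissible denominator. -/
def AlmostCoprime (p q : ℝ[X][X]) : Prop :=
  ∃ a b : ℝ[X][X], ∃ g : ℝ[X], IsDenom g ∧ a * p + b * q = C g

lemma AlmostCoprime.symm {p q : ℝ[X][X]} (h : AlmostCoprime p q) : AlmostCoprime q p := by
  obtain ⟨a, b, g, hg, h⟩ := h
  exact ⟨b, a, g, hg, by rw [← h]; ring⟩

lemma AlmostCoprime.prod_left {ι : Type*} (s : Finset ι) (p : ι → ℝ[X][X]) (q : ℝ[X][X])
    (h : ∀ i ∈ s, AlmostCoprime (p i) q) : AlmostCoprime (∏ i ∈ s, p i) q := by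
  classical
  induction s using Finset.induction_on with
  | empty => exact ⟨1, 0, 1, IsDenom.one, by simp⟩
  | insert i s hi ih =>
    obtain ⟨a, b, g, hg, e⟩ := h i (Finset.mem_insert_self i s)
    obtain ⟨a', b', g', hg', e'⟩ := ih fun j hj => h j (Finset.mem_insert_of_mem hj)
    refine ⟨a * a', a * p i * b' + b * a' * (∏ i ∈ s, p i) + b * b' * q, g * g',
      hg.mul hg', ?_⟩
    rw [Finset.prod_insert hi, C_mul, ← e, ← e']
    ring

lemma almostCoprime_factors {m n : ℕ} (hm : 0 < m) :
    AlmostCoprime (X ^ m - C X) (1 - C X * X ^ n) := by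
  obtain ⟨a, ha⟩ := sub_dvd_pow_sub_pow (X ^ m : ℝ[X][X]) (C X) n
  obtain ⟨b, hb⟩ := sub_dvd_pow_sub_pow (1 : ℝ[X][X]) (C X * X ^ n) m
  refine ⟨C X ^ m * a, b, 1 - X ^ (m + n), IsDenom.one_sub_X_pow (by omega), ?_⟩
  have : C X ^ m * a * (X ^ m - C X) + b * (1 - C X * X ^ n)
      = C X ^ m * ((X ^ m - C X) * a) + (1 - C X * X ^ n) * b := by ring
  rw [this, ← ha, ← hb]
  simp only [C_sub, C_1, C_pow]
  ring

variable {ι : Type*} (s : Finset ι) (m : ι → ℕ)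

/-- Denominator factor coming from the negative weights. -/
def negFactor : ℝ[X][X] := ∏ i ∈ s, (X ^ m i - C X)

/-- Denominator factor coming from the positive weights. -/
def posFactor : ℝ[X][X] := ∏ i ∈ s, (1 - C X * X ^ m i)

lemma almostCoprime_negFactor_posFactor (hm : ∀ i ∈ s, 0 < m i) :
    AlmostCoprime (negFactor s m) (posFactor s m) :=
  AlmostCoprime.prod_left _ _ _ fun _ hi =>
    (AlmostCoprime.prod_left _ _ _ fun _ _ => (almostCoprime_factors (hm _ hi)).symm).symm

lemma negFactor_monic (hm : ∀ i ∈ s, 0 < m i) : (negFactor s m).Monic :=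
  monic_prod_of_monic _ _ fun i hi => monic_X_pow_sub_C _ (hm i hi).ne'

lemma negFactor_natDegree (hm : ∀ i ∈ s, 0 < m i) :
    (negFactor s m).natDegree = ∑ i ∈ s, m i := by
  rw [negFactor, natDegree_prod_of_monic _ _ fun i hi => monic_X_pow_sub_C _ (hm i hi).ne']
  simp

lemma posFactor_natDegree_le : (posFactor s m).natDegree ≤ ∑ i ∈ s, m i := by
  refine (natDegree_prod_le _ _).trans (Finset.sum_le_sum fun i _ => ?_)
  compute_degree

lemma posFactor_coeff (hm : ∀ i ∈ s, 0 < m i) :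
    (posFactor s m).coeff (∑ i ∈ s, m i) = (-X) ^ s.card := by
  classical
  have : ∀ s : Finset ι, (∀ i ∈ s, 0 < m i) →
      (posFactor s m).coeff (∑ i ∈ s, m i) = (-X) ^ s.card := by
    intro s
    induction s using Finset.induction_on with
    | empty => simp [posFactor]
    | insert i s hi ih =>
      intro hm
      rw [posFactor, Finset.prod_insert hi, Finset.sum_insert hi, Finset.card_insert_of_notMem hi,
        ← posFactor,
        coeff_mul_add_eq_of_natDegree_le (by compute_degree) (posFactor_natDegree_le s m),
        ih fun j hj => hm j (Finset.mem_insert_of_mem hj)]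
      have := (hm i (Finset.mem_insert_self i s)).ne'
      simp [coeff_one, this, pow_succ']
  exact this s hm

lemma exists_partial_fractions (hm : ∀ i ∈ s, 0 < m i) (hS : 3 ≤ ∑ i ∈ s, m i) :
    ∃ U V : ℝ[X][X], ∃ g : ℝ[X], IsDenom g ∧
      U * negFactor s m + V * posFactor s m
        = C g * (X ^ (∑ i ∈ s, m i - 1) - X ^ (∑ i ∈ s, m i - 3)) ∧
      U.natDegree < ∑ i ∈ s, m i ∧ V.natDegree < ∑ i ∈ s, m i ∧
      U.coeff (∑ i ∈ s, m i - 1) = - (V.coeff (∑ i ∈ s, m i - 1) * (-X) ^ s.card) := by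
  obtain ⟨a, b, g, hg, e⟩ := almostCoprime_negFactor_posFactor s m hm
  have hp := negFactor_monic s m hm
  have hpd := negFactor_natDegree s m hm
  have hqd := posFactor_natDegree_le s m
  have hqc := posFactor_coeff s m hm
  set p := negFactor s m
  set q := posFactor s m
  set S := ∑ i ∈ s, m i
  set N : ℝ[X][X] := X ^ (S - 1) - X ^ (S - 3) with hN
  set V := (b * N) %ₘ p with hV
  set U := a * N + q * ((b * N) /ₘ p) with hU
  have hdiv := modByMonic_add_div (b * N) p
  have key : U * p + V * q = C g * N := by
    rw [← e]
    calc U * p + V * q = a * p * N + q * (V + p * ((b * N) /ₘ p)) := by rw [hU]; ring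
      _ = _ := by rw [hV, hdiv]; ring
  have hVd : V.natDegree < S := by
    rw [← hpd]
    exact natDegree_modByMonic_lt _ hp fun h => by
      have := hpd; rw [h] at this; simp at this; omega
  have hNd : N.natDegree ≤ S - 1 := by
    rw [hN]
    refine (natDegree_sub_le _ _).trans ?_
    simp; omega
  have hUd : U.natDegree < S := by
    have h1 : (U * p).natDegree ≤ 2 * S - 1 := by
      rw [eq_sub_of_add_eq key]
      refine (natDegree_sub_le _ _).trans (max_le ?_ ?_)
      · refine (natDegree_C_mul_le _ _).trans ?_
        omega
      · refine natDegree_mul_le.trans ?_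
        omega
    by_contra hcon
    have : U ≠ 0 := by rintro h; rw [h] at hcon; simp at hcon; omega
    rw [mul_comm, hp.natDegree_mul' this, hpd] at h1
    omega
  refine ⟨U, V, g, hg, key, hUd, hVd, ?_⟩
  have h2 := congrArg (fun f => coeff f ((S - 1) + S)) key
  simp only [coeff_add] at h2
  rw [coeff_mul_add_eq_of_natDegree_le (by omega) hpd.le, coeff_mul_add_eq_of_natDegree_le (by omega) hqd, hqc,
    coeff_eq_zero_of_natDegree_lt (p := C g * N)
      (((natDegree_C_mul_le _ _).trans hNd).trans_lt (by omega))] at h2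
  have h3 : p.coeff S = 1 := by rw [← hpd]; exact hp
  rw [h3, mul_one] at h2
  exact eq_neg_of_add_eq_zero_left h2

lemma map_negFactor_inv {t : ℝ} (ht : t ≠ 0) :
    (negFactor s m).map (evalRingHom t⁻¹)
      = C ((-t⁻¹) ^ s.card) * (posFactor s m).map (evalRingHom t) := by
  have hc : (C ((-t⁻¹) ^ s.card) : ℝ[X]) = ∏ _i ∈ s, C (-t⁻¹) := by
    rw [Finset.prod_const, C_pow]
  rw [hc, negFactor, posFactor, Polynomial.map_prod, Polynomial.map_prod,
    ← Finset.prod_mul_distrib]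
  refine Finset.prod_congr rfl fun i _ => ?_
  have : (C t⁻¹ : ℝ[X]) * C t = 1 := by rw [← C_mul, inv_mul_cancel₀ ht, C_1]
  simp only [Polynomial.map_sub, Polynomial.map_pow, map_X, map_C, coe_evalRingHom, eval_X,
    Polynomial.map_one, Polynomial.map_mul, C_neg]
  linear_combination (-X ^ m i) * this

lemma map_posFactor_inv {t : ℝ} (ht : t ≠ 0) :
    (posFactor s m).map (evalRingHom t⁻¹)
      = C ((-t⁻¹) ^ s.card) * (negFactor s m).map (evalRingHom t) := by
  have hc : (C ((-t⁻¹) ^ s.card) : ℝ[X]) = ∏ _i ∈ s, C (-t⁻¹) := by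
    rw [Finset.prod_const, C_pow]
  rw [hc, negFactor, posFactor, Polynomial.map_prod, Polynomial.map_prod,
    ← Finset.prod_mul_distrib]
  refine Finset.prod_congr rfl fun i _ => ?_
  have : (C t⁻¹ : ℝ[X]) * C t = 1 := by rw [← C_mul, inv_mul_cancel₀ ht, C_1]
  simp only [Polynomial.map_sub, Polynomial.map_pow, map_X, map_C, coe_evalRingHom, eval_X,
    Polynomial.map_one, Polynomial.map_mul, C_neg]
  linear_combination -this

lemma partial_fractions_reciprocity (hm : ∀ i ∈ s, 0 < m i)
    {U V : ℝ[X][X]} {g : ℝ[X]}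
    (key : U * negFactor s m + V * posFactor s m
        = C g * (X ^ (∑ i ∈ s, m i - 1) - X ^ (∑ i ∈ s, m i - 3)))
    (hU : U.natDegree < ∑ i ∈ s, m i) (hV : V.natDegree < ∑ i ∈ s, m i)
    (hUV : U.coeff (∑ i ∈ s, m i - 1) = - (V.coeff (∑ i ∈ s, m i - 1) * (-X) ^ s.card))
    {t : ℝ} (h0 : 0 < t) (h1 : t ≠ 1) :
    g.eval t⁻¹ * (V.coeff (∑ i ∈ s, m i - 1)).eval t * t ^ (2 * s.card)
      = - (g.eval t * (V.coeff (∑ i ∈ s, m i - 1)).eval t⁻¹) := by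
  obtain ⟨a, b, g', hg', e⟩ := almostCoprime_negFactor_posFactor s m hm
  have hp := (negFactor_monic s m hm).map (evalRingHom t)
  have hpd : ((negFactor s m).map (evalRingHom t)).natDegree = ∑ i ∈ s, m i := by
    rw [(negFactor_monic s m hm).natDegree_map, negFactor_natDegree s m hm]
  have k1 := congrArg (Polynomial.map (evalRingHom t)) key
  have k2 := congrArg (Polynomial.map (evalRingHom t⁻¹)) key
  have e1 := congrArg (Polynomial.map (evalRingHom t)) e
  simp only [Polynomial.map_add, Polynomial.map_mul, map_C, Polynomial.map_sub,
    Polynomial.map_pow, map_X, coe_evalRingHom] at k1 k2 e1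
  rw [map_negFactor_inv s m h0.ne', map_posFactor_inv s m h0.ne'] at k2
  set p := (negFactor s m).map (evalRingHom t)
  set q := (posFactor s m).map (evalRingHom t)
  set S := ∑ i ∈ s, m i
  set c : ℝ := (-t⁻¹) ^ s.card with hc
  have hcop : IsCoprime p q := by
    have hu : (C (g'.eval t)⁻¹ : ℝ[X]) * C (g'.eval t) = 1 := by
      rw [← C_mul, inv_mul_cancel₀ (hg'.2 t h0 h1), C_1]
    exact ⟨C (g'.eval t)⁻¹ * a.map (evalRingHom t), C (g'.eval t)⁻¹ * b.map (evalRingHom t), by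
      rw [← hu, ← e1]; ring⟩
  set W : ℝ[X] := C (g.eval t⁻¹) * V.map (evalRingHom t)
    - C (g.eval t * c) * U.map (evalRingHom t⁻¹) with hW
  have hdvd : p ∣ W := by
    refine hcop.dvd_of_dvd_mul_right ⟨C (g.eval t * c) * V.map (evalRingHom t⁻¹)
      - C (g.eval t⁻¹) * U.map (evalRingHom t), ?_⟩
    rw [hW, C_mul]
    linear_combination (C (g.eval t⁻¹)) * k1 - C (g.eval t) * k2
  have hW0 : W = 0 := by
    refine eq_zero_of_dvd_of_natDegree_lt hdvd ?_
    rw [hpd]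
    refine (natDegree_sub_le _ _).trans_lt (max_lt ?_ ?_)
    · exact ((natDegree_C_mul_le _ _).trans natDegree_map_le).trans_lt hV
    · exact ((natDegree_C_mul_le _ _).trans natDegree_map_le).trans_lt hU
  have h2 := congrArg (fun f => coeff f (S - 1)) hW0
  simp only [hW, coeff_sub, coeff_C_mul, coeff_map, coe_evalRingHom, coeff_zero, hUV, eval_neg,
    eval_mul, eval_pow, eval_X] at h2
  have hct : c * c * t ^ (2 * s.card) = 1 := by
    rw [hc, ← mul_pow, pow_mul, ← mul_pow]
    have : -t⁻¹ * -t⁻¹ * t ^ 2 = 1 := by field_simp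
    rw [this, one_pow]
  linear_combination t ^ (2 * s.card) * h2
    - g.eval t * (V.coeff (S - 1)).eval t⁻¹ * hct

end Reciprocity
section ConstantTerm
open Polynomial
open scoped LaurentPolynomial PowerSeries

/-- The coefficient of `z ^ j` in a power series whose coefficients are Laurent polynomials
in `z`. -/
def laurentCoeff (j : ℤ) (F : ℝ[T;T⁻¹]⟦X⟧) : ℝ⟦X⟧ :=
  PowerSeries.mk fun n => (PowerSeries.coeff n F).coeff j

lemma laurentCoeff_add (j : ℤ) (F G : ℝ[T;T⁻¹]⟦X⟧) :
    laurentCoeff j (F + G) = laurentCoeff j F + laurentCoeff j G := by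
  ext n; simp [laurentCoeff]

lemma laurentCoeff_sub (j : ℤ) (F G : ℝ[T;T⁻¹]⟦X⟧) :
    laurentCoeff j (F - G) = laurentCoeff j F - laurentCoeff j G := by
  ext n; simp [laurentCoeff]

lemma laurentCoeff_sum {ι : Type*} (s : Finset ι) (j : ℤ) (F : ι → ℝ[T;T⁻¹]⟦X⟧) :
    laurentCoeff j (∑ i ∈ s, F i) = ∑ i ∈ s, laurentCoeff j (F i) := by
  ext n; simp [laurentCoeff, AddMonoidAlgebra.coeff_sum]

lemma laurentCoeff_T_mul (i j : ℤ) (F : ℝ[T;T⁻¹]⟦X⟧) :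
    laurentCoeff j (PowerSeries.C (LaurentPolynomial.T i) * F) = laurentCoeff (j - i) F := by
  ext n
  simp only [laurentCoeff, PowerSeries.coeff_mk, PowerSeries.coeff_C_mul, LaurentPolynomial.T]
  rw [AddMonoidAlgebra.coeff_single_mul_apply, one_mul, neg_add_eq_sub]

lemma laurentCoeff_map_C_mul (j : ℤ) (a : ℝ⟦X⟧) (F : ℝ[T;T⁻¹]⟦X⟧) :
    laurentCoeff j (PowerSeries.map LaurentPolynomial.C a * F) = a * laurentCoeff j F := by
  ext n
  simp only [laurentCoeff, PowerSeries.coeff_mk, PowerSeries.coeff_mul, PowerSeries.coeff_map,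
    AddMonoidAlgebra.coeff_sum, Finsupp.coe_finsetSum, Finset.sum_apply]
  refine Finset.sum_congr rfl fun p _ => ?_
  rw [← LaurentPolynomial.single_eq_C]
  exact AddMonoidAlgebra.coeff_single_zero_mul _ _ _

lemma laurentCoeff_map_toLaurent {j : ℤ} (hj : j < 0) (F : ℝ[X]⟦X⟧) :
    laurentCoeff j (PowerSeries.map toLaurent F) = 0 := by
  ext n
  simp only [laurentCoeff, PowerSeries.coeff_mk, PowerSeries.coeff_map, map_zero]
  rw [LaurentPolynomial.coeff_toLaurent, Finsupp.mapDomain_of_notMem_range]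
  simp
  intro x
  omega

/-- The substitution `z ↦ z⁻¹` on polynomials in `z`. -/
def toLaurentInv : ℝ[X] →+* ℝ[T;T⁻¹] :=
  (LaurentPolynomial.invert (R := ℝ) : ℝ[T;T⁻¹] →+* ℝ[T;T⁻¹]).comp toLaurent

lemma toLaurentInv_apply (f : ℝ[X]) :
    toLaurentInv f = LaurentPolynomial.invert (toLaurent f) := rfl

lemma laurentCoeff_map_toLaurentInv {j : ℤ} (hj : 0 < j) (F : ℝ[X]⟦X⟧) :
    laurentCoeff j (PowerSeries.map toLaurentInv F) = 0 := by
  have := laurentCoeff_map_toLaurent (neg_neg_of_pos hj) F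
  ext n
  have h := congrArg (PowerSeries.coeff n) this
  simpa [laurentCoeff, toLaurentInv_apply] using h

lemma laurentCoeff_zero_map_toLaurentInv (F : ℝ[X]⟦X⟧) :
    laurentCoeff 0 (PowerSeries.map toLaurentInv F) = PowerSeries.map (evalRingHom 0) F := by
  ext n
  simp only [laurentCoeff, PowerSeries.coeff_mk, PowerSeries.coeff_map, toLaurentInv_apply,
    LaurentPolynomial.invert_apply, neg_zero, coe_evalRingHom, ← coeff_zero_eq_eval_zero]
  rw [LaurentPolynomial.coeff_toLaurent]
  exact Finsupp.mapDomain_apply Nat.castEmbedding.injective _ _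

/-- The reinterpretation of polynomials in `t` and `z` as power series in `t`. -/
def swapVars : ℝ[X][X] →+* ℝ[X]⟦X⟧ :=
  eval₂RingHom (eval₂RingHom (PowerSeries.C.comp Polynomial.C) PowerSeries.X) (PowerSeries.C X)

lemma swapVars_X : swapVars X = PowerSeries.C X := by simp [swapVars]

lemma swapVars_C_X : swapVars (C X) = PowerSeries.X := by simp [swapVars]

lemma map_toLaurent_swapVars_C (g : ℝ[X]) :
    PowerSeries.map toLaurent (swapVars (C g))
      = PowerSeries.map LaurentPolynomial.C (g : ℝ⟦X⟧) := by
  have : ((PowerSeries.map toLaurent).comp swapVars).comp (C : ℝ[X] →+* ℝ[X][X])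
      = (PowerSeries.map LaurentPolynomial.C).comp (Polynomial.coeToPowerSeries.ringHom) := by
    refine Polynomial.ringHom_ext (fun a => ?_) ?_
    · simp [swapVars]
    · simp [swapVars]
  exact congrArg (fun f => f g) this

variable {ι : Type*} (s : Finset ι) (m : ι → ℕ)

lemma map_toLaurent_swapVars_posFactor :
    PowerSeries.map toLaurent (swapVars (posFactor s m))
      = ∏ i ∈ s, (1 - PowerSeries.C (LaurentPolynomial.T (m i)) * PowerSeries.X) := by
  simp only [posFactor, map_prod, map_sub, map_one, map_mul, map_pow, swapVars_X, swapVars_C_X,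
    PowerSeries.map_X, PowerSeries.map_C, toLaurent_X]
  refine Finset.prod_congr rfl fun i _ => ?_
  rw [← map_pow, LaurentPolynomial.T_pow, mul_one, mul_comm]

lemma map_toLaurentInv_swapVars_posFactor :
    PowerSeries.map toLaurentInv (swapVars (posFactor s m))
      = ∏ i ∈ s, (1 - PowerSeries.C (LaurentPolynomial.T (-(m i : ℤ))) * PowerSeries.X) := by
  simp only [posFactor, map_prod, map_sub, map_one, map_mul, map_pow, swapVars_X, swapVars_C_X,
    PowerSeries.map_X, PowerSeries.map_C, toLaurentInv_apply, toLaurent_X,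
    LaurentPolynomial.invert_T]
  refine Finset.prod_congr rfl fun i _ => ?_
  rw [← map_pow, LaurentPolynomial.T_pow, mul_neg_one, mul_comm]

lemma map_toLaurent_swapVars_negFactor :
    PowerSeries.map toLaurent (swapVars (negFactor s m))
      = PowerSeries.C (LaurentPolynomial.T (∑ i ∈ s, m i : ℕ))
        * PowerSeries.map toLaurentInv (swapVars (posFactor s m)) := by
  have : (PowerSeries.C (LaurentPolynomial.T (∑ i ∈ s, m i : ℕ)) : ℝ[T;T⁻¹]⟦X⟧)
      = ∏ i ∈ s, PowerSeries.C (LaurentPolynomial.T (m i)) := by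
    rw [← map_prod]
    congr 1
    simp only [← Polynomial.toLaurent_X_pow, ← map_prod, Finset.prod_pow_eq_pow_sum]
  rw [map_toLaurentInv_swapVars_posFactor, this, ← Finset.prod_mul_distrib]
  simp only [negFactor, map_prod, map_sub, map_pow, swapVars_X, swapVars_C_X,
    PowerSeries.map_X, PowerSeries.map_C, toLaurent_X]
  refine Finset.prod_congr rfl fun i _ => ?_
  rw [← map_pow, LaurentPolynomial.T_pow, mul_one, mul_sub, mul_one, ← mul_assoc, ← map_mul,
    ← LaurentPolynomial.T_add, add_neg_cancel, LaurentPolynomial.T_zero, map_one, one_mul]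

lemma exists_inverse_swapVars_posFactor (hm : ∀ i ∈ s, 0 < m i) :
    ∃ E : ℝ[X]⟦X⟧, swapVars (posFactor s m) * E = 1 ∧ PowerSeries.map (evalRingHom 0) E = 1 := by
  have h1 : PowerSeries.constantCoeff (swapVars (posFactor s m)) = ((1 : ℝ[X]ˣ) : ℝ[X]) := by
    simp [posFactor, swapVars_C_X]
  refine ⟨PowerSeries.invOfUnit _ 1, PowerSeries.mul_invOfUnit _ 1 h1, ?_⟩
  have h2 := congrArg (PowerSeries.map (evalRingHom (0 : ℝ))) (PowerSeries.mul_invOfUnit _ 1 h1)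
  rw [map_mul, map_one] at h2
  have h3 : PowerSeries.map (evalRingHom (0 : ℝ)) (swapVars (posFactor s m)) = 1 := by
    simp only [posFactor, map_prod, map_sub, map_one, map_mul, map_pow, swapVars_X, swapVars_C_X,
      PowerSeries.map_X, PowerSeries.map_C, coe_evalRingHom, eval_X, map_zero]
    refine Finset.prod_eq_one fun i hi => ?_
    rw [zero_pow (hm i hi).ne', mul_zero, sub_zero]
  rwa [h3, one_mul] at h2

lemma exists_rational_reciprocity (hm : ∀ i ∈ s, 0 < m i) (hS : 3 ≤ ∑ i ∈ s, m i) (e : ℕ)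
    {G : ℝ[T;T⁻¹]⟦X⟧}
    (hG : G * ((∏ i ∈ s, (1 - PowerSeries.C (LaurentPolynomial.T (-(m i : ℤ))) * PowerSeries.X))
      * (∏ i ∈ s, (1 - PowerSeries.C (LaurentPolynomial.T (m i : ℤ)) * PowerSeries.X))
      * (1 - PowerSeries.X) ^ e) = 1) :
    ∃ v B : ℝ[X], IsDenom B ∧ (laurentCoeff 0 G - laurentCoeff 2 G) * (B : ℝ⟦X⟧) = v ∧
      ∀ t : ℝ, 0 < t → t ≠ 1 → v.eval t * B.eval t⁻¹ * t ^ (2 * s.card + e)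
        = -(-1) ^ e * (v.eval t⁻¹ * B.eval t) := by
  obtain ⟨U, V, g, hg, key, hU, hV, hUV⟩ := exists_partial_fractions s m hm hS
  obtain ⟨E, hE, hE0⟩ := exists_inverse_swapVars_posFactor s m hm
  set S := ∑ i ∈ s, m i with hSdef
  refine ⟨V.coeff (S - 1), g * (1 - X ^ 1) ^ e, hg.mul ((IsDenom.one_sub_X_pow one_ne_zero).pow e),
    ?_, fun t h0 h1 => ?_⟩
  · rw [← map_toLaurent_swapVars_posFactor, ← map_toLaurentInv_swapVars_posFactor] at hG
    have h1 := congrArg (PowerSeries.map toLaurent) hE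
    have h2 := congrArg (PowerSeries.map toLaurentInv) hE
    have h3 := congrArg (fun f => PowerSeries.map toLaurent (swapVars f)) key
    simp only [map_mul, map_one, map_add, map_sub, map_pow, map_toLaurent_swapVars_negFactor,
      map_toLaurent_swapVars_C, swapVars_X, PowerSeries.map_C, toLaurent_X] at h1 h2 h3
    rw [← map_pow, ← map_pow, LaurentPolynomial.T_pow, LaurentPolynomial.T_pow, mul_one, mul_one,
      ← hSdef] at h3
    have hT : ∀ i j : ℤ, (PowerSeries.C (LaurentPolynomial.T (i + j)) : ℝ[T;T⁻¹]⟦X⟧)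
        = PowerSeries.C (LaurentPolynomial.T i) * PowerSeries.C (LaurentPolynomial.T j) := by
      intro i j; rw [← map_mul, LaurentPolynomial.T_add]
    have hT0 : (PowerSeries.C (LaurentPolynomial.T (-(S : ℤ))) : ℝ[T;T⁻¹]⟦X⟧)
        * PowerSeries.C (LaurentPolynomial.T (S : ℕ)) = 1 := by
      rw [← hT, neg_add_cancel, LaurentPolynomial.T_zero, map_one]
    have hS1 : (PowerSeries.C (LaurentPolynomial.T ((S - 1 : ℕ) : ℤ)) : ℝ[T;T⁻¹]⟦X⟧)
        = PowerSeries.C (LaurentPolynomial.T (S : ℕ)) * PowerSeries.C (LaurentPolynomial.T (-1)) := by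
      rw [← hT]; congr 2; omega
    have hS3 : (PowerSeries.C (LaurentPolynomial.T ((S - 3 : ℕ) : ℤ)) : ℝ[T;T⁻¹]⟦X⟧)
        = PowerSeries.C (LaurentPolynomial.T (S : ℕ)) * PowerSeries.C (LaurentPolynomial.T (-3)) := by
      rw [← hT]; congr 2; omega
    rw [hS1, hS3] at h3
    have h4 : PowerSeries.map LaurentPolynomial.C (g : ℝ⟦X⟧) * (1 - PowerSeries.X) ^ e
          * (PowerSeries.C (LaurentPolynomial.T (-1)) * G
            - PowerSeries.C (LaurentPolynomial.T (-3)) * G)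
        = PowerSeries.map toLaurent (swapVars U * E)
          + PowerSeries.C (LaurentPolynomial.T (-(S : ℤ)))
            * (PowerSeries.map toLaurent (swapVars V) * PowerSeries.map toLaurentInv E) := by
      rw [map_mul]
      generalize PowerSeries.map LaurentPolynomial.C (g : ℝ⟦X⟧) = g' at *
      generalize PowerSeries.map toLaurent (swapVars U) = U' at *
      generalize PowerSeries.map toLaurent (swapVars V) = V' at *
      generalize PowerSeries.map toLaurent E = E' at *
      generalize PowerSeries.map toLaurentInv E = E'' at *
      generalize PowerSeries.map toLaurent (swapVars (posFactor s m)) = P' at *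
      generalize PowerSeries.map toLaurentInv (swapVars (posFactor s m)) = P'' at *
      generalize (PowerSeries.C (LaurentPolynomial.T (S : ℕ)) : ℝ[T;T⁻¹]⟦X⟧) = z at *
      generalize (PowerSeries.C (LaurentPolynomial.T (-(S : ℤ))) : ℝ[T;T⁻¹]⟦X⟧) = z' at *
      generalize (PowerSeries.C (LaurentPolynomial.T (-1)) : ℝ[T;T⁻¹]⟦X⟧) = z1 at *
      generalize (PowerSeries.C (LaurentPolynomial.T (-3)) : ℝ[T;T⁻¹]⟦X⟧) = z3 at *
      generalize ((1 - PowerSeries.X) ^ e : ℝ[T;T⁻¹]⟦X⟧) = x at *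
      have h5 : G * x = E' * E'' := by
        calc G * x = G * x * (P' * E') * (P'' * E'') := by rw [h1, h2]; ring
          _ = G * (P'' * P' * x) * (E' * E'') := by ring
          _ = _ := by rw [hG, one_mul]
      calc g' * x * (z1 * G - z3 * G) = (G * x) * (z' * z) * (g' * (z1 - z3)) := by
            rw [hT0]; ring
        _ = E' * E'' * z' * (g' * (z * z1 - z * z3)) := by rw [h5]; ring
        _ = E' * E'' * z' * (U' * (z * P'') + V' * P') := by rw [h3]
        _ = U' * E' * (z' * z) * (P'' * E'') + z' * (V' * E'') * (P' * E') := by ring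
        _ = _ := by rw [hT0, h1, h2]; ring
    have h6 := congrArg (laurentCoeff (-1)) h4
    have hx : PowerSeries.map LaurentPolynomial.C (g : ℝ⟦X⟧) * (1 - PowerSeries.X) ^ e
        = PowerSeries.map LaurentPolynomial.C ((g * (1 - X ^ 1) ^ e : ℝ[X]) : ℝ⟦X⟧) := by
      simp
    rw [hx, laurentCoeff_map_C_mul, laurentCoeff_sub, laurentCoeff_T_mul, laurentCoeff_T_mul,
      laurentCoeff_add, laurentCoeff_map_toLaurent (by norm_num), zero_add,
      laurentCoeff_T_mul] at h6
    norm_num at h6 ⊢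
    rw [mul_comm, h6]
    conv_lhs => rw [V.as_sum_range_C_mul_X_pow' hV]
    simp only [map_sum, map_mul, map_toLaurent_swapVars_C, map_pow, swapVars_X, PowerSeries.map_C,
      toLaurent_X, Finset.sum_mul, laurentCoeff_sum]
    rw [Finset.sum_eq_single_of_mem (S - 1) (by simp; omega)]
    · rw [mul_assoc, laurentCoeff_map_C_mul, ← map_pow, LaurentPolynomial.T_pow,
        laurentCoeff_T_mul]
      have : (-1 + (S : ℤ) - ((S - 1 : ℕ) : ℤ) * 1) = 0 := by omega
      rw [this, laurentCoeff_zero_map_toLaurentInv, hE0, mul_one]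
    · intro i hi hi'
      rw [Finset.mem_range] at hi
      rw [mul_assoc, laurentCoeff_map_C_mul, ← map_pow, LaurentPolynomial.T_pow,
        laurentCoeff_T_mul, laurentCoeff_map_toLaurentInv (by omega), mul_zero]
  · have h := partial_fractions_reciprocity s m hm key hU hV hUV h0 h1
    simp only [eval_mul, eval_pow, eval_sub, eval_one, eval_X, pow_one]
    have h2 : (1 - t⁻¹) ^ e * t ^ e = (-1) ^ e * (1 - t) ^ e := by
      rw [← mul_pow, ← mul_pow]; congr 1; field_simp; ring
    rw [pow_add]
    linear_combination (1 - t⁻¹) ^ e * t ^ e * h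
      - g.eval t * (V.coeff (S - 1)).eval t⁻¹ * h2

end ConstantTerm
section Degree
open Polynomial Filter Topology
open scoped PowerSeries

lemma degree_le_of_div_tendsto {P Q : ℝ[X]} {c : ℝ} (hc : c ≠ 0)
    (h : Tendsto (fun t => P.eval t / Q.eval t) atTop (𝓝 c)) : Q.degree ≤ P.degree := by
  by_contra hlt
  exact hc (tendsto_nhds_unique h (div_tendsto_atTop_zero_of_degree_lt P Q (not_le.1 hlt)))

lemma natDegree_eq_of_reciprocity {v B : ℝ[X]} (hv : v.eval 0 = 1) (hB : IsDenom B) (D : ℕ)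
    {c : ℝ} (hc : c ≠ 0)
    (h : ∀ t : ℝ, 0 < t → t ≠ 1 → v.eval t * B.eval t⁻¹ * t ^ D = c * (v.eval t⁻¹ * B.eval t)) :
    v.natDegree + D = B.natDegree := by
  have hlim : ∀ f : ℝ[X], Tendsto (fun t : ℝ => f.eval t⁻¹) atTop (𝓝 (f.eval 0)) := fun f =>
    (f.continuous.tendsto 0).comp tendsto_inv_atTop_zero
  have h1 : Tendsto (fun t : ℝ => (v * X ^ D).eval t / B.eval t) atTop (𝓝 c) := by
    have h2 : Tendsto (fun t : ℝ => c * (v.eval t⁻¹ / B.eval t⁻¹)) atTop (𝓝 c) := by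
      have := ((hlim v).div (hlim B) (by rw [hB.1]; exact one_ne_zero)).const_mul c
      simpa [hv, hB.1] using this
    refine h2.congr' ?_
    filter_upwards [eventually_gt_atTop 1] with t ht
    have ht0 : 0 < t := by linarith
    have b1 := hB.2 t ht0 ht.ne'
    have b2 := hB.2 t⁻¹ (inv_pos.2 ht0) (by simpa using ht.ne')
    have := h t ht0 ht.ne'
    simp only [eval_mul, eval_pow, eval_X]
    rw [← mul_div_assoc, div_eq_div_iff b2 b1]
    linear_combination -this
  have h3 : Tendsto (fun t : ℝ => B.eval t / (v * X ^ D).eval t) atTop (𝓝 c⁻¹) := by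
    simpa using h1.inv₀ hc
  have h4 := le_antisymm (degree_le_of_div_tendsto hc h1)
    (degree_le_of_div_tendsto (inv_ne_zero hc) h3)
  have hv0 : v ≠ 0 := by rintro rfl; simp at hv
  rw [natDegree_eq_natDegree h4, natDegree_mul_X_pow _ hv0]

lemma tsum_mul_eval {a : ℕ → ℝ} {v B : ℝ[X]}
    (hB : PowerSeries.mk a * (B : ℝ⟦X⟧) = v) {t : ℝ} (ha : Summable fun n => ‖a n * t ^ n‖) :
    (∑' n, a n * t ^ n) * B.eval t = v.eval t := by
  have hev : ∀ f : ℝ[X], HasSum (fun n => f.coeff n * t ^ n) (f.eval t) := fun f => by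
    rw [eval_eq_sum, Polynomial.sum]
    exact hasSum_sum_of_ne_finset_zero fun n hn => by
      rw [notMem_support_iff.1 hn, zero_mul]
  have hs : Summable fun n => ‖B.coeff n * t ^ n‖ := by
    refine summable_of_ne_finset_zero (s := B.support) fun n hn => ?_
    rw [notMem_support_iff.1 hn, zero_mul, norm_zero]
  rw [← (hev B).tsum_eq, ← (hev v).tsum_eq,
    tsum_mul_tsum_eq_tsum_sum_antidiagonal_of_summable_norm ha hs]
  refine tsum_congr fun n => ?_
  rw [← Polynomial.coeff_coe, ← hB, PowerSeries.coeff_mul, Finset.sum_mul]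
  refine Finset.sum_congr rfl fun p hp => ?_
  rw [PowerSeries.coeff_mk, Polynomial.coeff_coe, ← Finset.HasAntidiagonal.mem_antidiagonal.1 hp, pow_add]
  ring

lemma rational_of_mul_eq {a : ℕ → ℝ} (ha0 : a 0 = 1)
    (ha : ∀ t ∈ Set.Ioo (0 : ℝ) 1, Summable fun n => ‖a n * t ^ n‖) {v B : ℝ[X]} (hB : IsDenom B)
    (hBv : PowerSeries.mk a * (B : ℝ⟦X⟧) = v) {D : ℕ} {c : ℝ} (hc : c ≠ 0)
    (h : ∀ t : ℝ, 0 < t → t ≠ 1 →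
      v.eval t * B.eval t⁻¹ * t ^ D = c * (v.eval t⁻¹ * B.eval t)) :
    (∃ P Q : ℝ[X], Q ≠ 0 ∧
      ∀ t ∈ Set.Ioo (0 : ℝ) 1, (∑' n, a n * t ^ n) * Q.eval t = P.eval t) ∧
    ∀ P Q : ℝ[X], Q ≠ 0 →
      (∀ t ∈ Set.Ioo (0 : ℝ) 1, (∑' n, a n * t ^ n) * Q.eval t = P.eval t) →
      (P.natDegree : ℤ) - (Q.natDegree : ℤ) = -(D : ℤ) := by
  have hB0 : B ≠ 0 := by rintro rfl; simpa using hB.1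
  have hv : v.eval 0 = 1 := by
    have h1 := congrArg (PowerSeries.coeff 0) hBv
    have h2 := hB.1
    rw [← coeff_zero_eq_eval_zero] at h2 ⊢
    rw [Polynomial.coeff_coe] at h1
    rw [← h1, PowerSeries.coeff_mul, Finset.HasAntidiagonal.antidiagonal_zero,
      Finset.sum_singleton, PowerSeries.coeff_mk, Polynomial.coeff_coe, ha0, h2,
      one_mul]
  have hv0 : v ≠ 0 := by rintro rfl; simp at hv
  refine ⟨⟨v, B, hB0, fun t ht => tsum_mul_eval hBv (ha t ht)⟩, fun P Q hQ hPQ => ?_⟩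
  have hcross : v * Q = P * B := by
    refine eq_of_infinite_eval_eq _ _ ((Set.Ioo_infinite one_pos).mono fun t ht => ?_)
    have h1 := tsum_mul_eval hBv (ha t ht)
    have h2 := hPQ t ht
    rw [Set.mem_ofPred_eq, eval_mul, eval_mul, ← h1, ← h2]
    ring
  have hP : P ≠ 0 := by
    rintro rfl
    rw [zero_mul] at hcross
    exact mul_ne_zero hv0 hQ hcross
  have hdeg := congrArg natDegree hcross
  rw [natDegree_mul hv0 hQ, natDegree_mul hP hB0] at hdeg
  have := natDegree_eq_of_reciprocity hv hB D hc h
  omega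

end Degree
section WeightSpaces

variable {A : Type*} [AddCommGroup A] [Module ℂ A] {E F : A →ₗ[ℂ] A} {W : ℤ → Submodule ℂ A}

lemma raise_pow_lower (hE : ∀ c, ∀ f ∈ W c, E f ∈ W (c + 2))
    (hEF : ∀ c, ∀ f ∈ W c, E (F f) - F (E f) = (c : ℂ) • f) (k : ℕ) :
    ∀ c, ∀ f ∈ W c, (E ^ (k + 1)) (F f)
      = F ((E ^ (k + 1)) f) + (((k : ℂ) + 1) * (c + k)) • (E ^ k) f := by
  induction k with
  | zero =>
    intro c f hf
    have := hEF c f hf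
    simp only [zero_add, pow_one, pow_zero, Module.End.one_apply, Nat.cast_zero, one_mul, add_zero]
    rw [← this]
    abel
  | succ k ih =>
    intro c f hf
    have h1 : E (F f) = F (E f) + (c : ℂ) • f := by
      rw [← hEF c f hf]; abel
    have h2 := ih (c + 2) (E f) (hE c f hf)
    have h3 (j : ℕ) : (E ^ j) (E f) = (E ^ (j + 1)) f := by rw [pow_succ, Module.End.mul_apply]
    rw [h3, h3] at h2
    rw [pow_succ, Module.End.mul_apply, h1, map_add, map_smul, h2, add_assoc, ← add_smul]
    congr 2
    push_cast
    ring

lemma exists_raise_eq (hE : ∀ c, ∀ f ∈ W c, E f ∈ W (c + 2)) (hF : ∀ c, ∀ f ∈ W c, F f ∈ W (c - 2))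
    (hEF : ∀ c, ∀ f ∈ W c, E (F f) - F (E f) = (c : ℂ) • f) {c : ℤ} (hc : 0 < c) (k : ℕ) :
    ∀ f ∈ W c, (E ^ k) f = 0 → ∃ u ∈ W (c - 2), E u = f := by
  induction k with
  | zero => exact fun f _ h => ⟨0, zero_mem _, by simpa using h.symm⟩
  | succ k ih =>
    intro f hf h
    have hcast : ((c : ℂ) + k) = ((c + k : ℤ) : ℂ) := by push_cast; rfl
    have hne : (((k : ℂ) + 1) * (c + k)) ≠ 0 := by
      refine mul_ne_zero (by exact_mod_cast k.succ_ne_zero) ?_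
      rw [hcast]
      exact_mod_cast (by omega : c + (k : ℤ) ≠ 0)
    set a : ℂ := ((k : ℂ) + 1) * (c + k)
    have hEFf : E (F f) ∈ W c := by simpa using hE _ _ (hF c f hf)
    obtain ⟨u, hu, hu'⟩ := ih (E (F f) - a • f) (sub_mem hEFf ((W c).smul_mem _ hf)) (by
      have := raise_pow_lower hE hEF k c f hf
      rw [h, map_zero, zero_add, pow_succ, Module.End.mul_apply] at this
      rw [map_sub, map_smul, this, sub_self])
    refine ⟨a⁻¹ • (F f - u), (W _).smul_mem _ (sub_mem (hF c f hf) hu), ?_⟩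
    rw [map_smul, map_sub, hu', sub_sub_cancel, inv_smul_smul₀ hne]

lemma pow_mem_weight (hE : ∀ c, ∀ f ∈ W c, E f ∈ W (c + 2)) (k : ℕ) :
    ∀ c, ∀ f ∈ W c, (E ^ k) f ∈ W (c + 2 * k) := by
  induction k with
  | zero => intro c f hf; simpa using hf
  | succ k ih =>
    intro c f hf
    rw [pow_succ, Module.End.mul_apply]
    have := ih _ _ (hE c f hf)
    have h : c + 2 + 2 * (k : ℤ) = c + 2 * ((k + 1 : ℕ) : ℤ) := by push_cast; ring
    rwa [h] at this

lemma raise_surjective (hE : ∀ c, ∀ f ∈ W c, E f ∈ W (c + 2))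
    (hF : ∀ c, ∀ f ∈ W c, F f ∈ W (c - 2))
    (hEF : ∀ c, ∀ f ∈ W c, E (F f) - F (E f) = (c : ℂ) • f) {b : ℤ}
    (hW : ∀ c, b < |c| → W c = ⊥) {c : ℤ} (hc : 0 < c) :
    ∀ f ∈ W c, ∃ u ∈ W (c - 2), E u = f := by
  intro f hf
  refine exists_raise_eq hE hF hEF hc b.toNat f hf ?_
  have := pow_mem_weight hE b.toNat c f hf
  rwa [hW _ (by rw [abs_of_nonneg (by omega)]; omega), Submodule.mem_bot] at this

lemma lower_eq_zero (hF : ∀ c, ∀ f ∈ W c, F f ∈ W (c - 2))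
    (hEF : ∀ c, ∀ f ∈ W c, E (F f) - F (E f) = (c : ℂ) • f) {b : ℤ}
    (hW : ∀ c, b < |c| → W c = ⊥) {f : A} (hf : f ∈ W 0) (hEf : E f = 0) : F f = 0 := by
  have hF' : ∀ c, ∀ f ∈ W (-c), F f ∈ W (-(c + 2)) := fun c f hf => by
    have := hF _ f hf
    rwa [show -c - 2 = -(c + 2) by ring] at this
  have hFE : ∀ c, ∀ f ∈ W (-c), F (E f) - E (F f) = (c : ℂ) • f := fun c f hf => by
    rw [← neg_sub, hEF _ f hf]; simp
  have h1 : F f ∈ W (-2) := by simpa using hF 0 f hf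
  have h2 : E (F f) = 0 := by simpa [hEf] using hEF 0 f hf
  have hnil : ∀ k : ℕ, (F ^ k) (F f) = 0 → F f = 0 := by
    intro k
    induction k with
    | zero => exact fun h => by simpa using h
    | succ k ih =>
      intro h
      have h3 := raise_pow_lower (W := fun c => W (-c)) hF' hFE k 2 (F f) h1
      rw [h, h2, map_zero, map_zero, zero_add] at h3
      refine ih ((smul_eq_zero.1 h3.symm).resolve_left ?_)
      push_cast
      exact_mod_cast (by positivity : (k + 1) * (2 + k) ≠ 0)
  refine hnil b.toNat ?_
  have := pow_mem_weight (W := fun c => W (-c)) hF' b.toNat 2 (F f) h1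
  beta_reduce at this
  rwa [hW _ (by rw [abs_neg, abs_of_nonneg (by omega)]; omega), Submodule.mem_bot] at this

end WeightSpaces
section Action
open MvPolynomial
open scoped MatrixGroups

/-- The linear substitution of variables given by `g`. -/
def linSubst (g : SL(2, ℂ)) : MvPolynomial (Fin 2) ℂ →ₐ[ℂ] MvPolynomial (Fin 2) ℂ :=
  aeval fun j : Fin 2 => ∑ l : Fin 2, C ((g : Matrix (Fin 2) (Fin 2) ℂ) j l) * X l

lemma linSubst_isHomogeneous (g : SL(2, ℂ)) {n : ℕ} {φ : MvPolynomial (Fin 2) ℂ}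
    (h : φ.IsHomogeneous n) : (linSubst g φ).IsHomogeneous n := by
  have hX (j : Fin 2) : (∑ l : Fin 2, C ((g : Matrix (Fin 2) (Fin 2) ℂ) j l) *
      X l : MvPolynomial (Fin 2) ℂ).IsHomogeneous 1 :=
    IsHomogeneous.sum _ _ _ fun l _ => isHomogeneous_C_mul_X _ l
  rw [← one_mul n]
  exact h.aeval _ hX

lemma linSubst_linSubst (g h : SL(2, ℂ)) (φ : MvPolynomial (Fin 2) ℂ) :
    linSubst g (linSubst h φ) = linSubst (h * g) φ := by
  have : (linSubst g).comp (linSubst h) = linSubst (h * g) := by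
    refine MvPolynomial.algHom_ext fun i => ?_
    simp only [linSubst, AlgHom.comp_apply, aeval_X, map_mul, algHom_C, Fin.sum_univ_two,
      algebraMap_eq, Matrix.SpecialLinearGroup.coe_mul, Matrix.mul_apply, map_add]
    ring
  exact congrArg (fun f => f φ) this

/-- The exponent of the monomial `x ^ i * y ^ j`. -/
def binExp (i j : ℕ) : Fin 2 →₀ ℕ := Finsupp.single 0 i + Finsupp.single 1 j

lemma binForm_eq_sum_monomial (n : ℕ) (v : Fin (n + 1) → ℂ) :
    binForm n v = ∑ i : Fin (n + 1), monomial (binExp i (n - i)) (v i) := by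
  refine Finset.sum_congr rfl fun i _ => ?_
  rw [binExp, mul_assoc, X_pow_eq_monomial, X_pow_eq_monomial, monomial_mul, C_mul_monomial]
  simp

lemma binExp_eq_iff {i n : ℕ} (hi : i ≤ n) {s : Fin 2 →₀ ℕ} :
    binExp i (n - i) = s ↔ s.degree = n ∧ s 0 = i := by
  have hdeg : s.degree = s 0 + s 1 := by
    rw [Finsupp.degree_eq_sum, Fin.sum_univ_two]
  rw [hdeg]
  constructor
  · rintro rfl
    simp [binExp]
    omega
  · rintro ⟨h1, h2⟩
    ext j
    fin_cases j
    · simp [binExp, h2]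
    · simp [binExp]; omega

lemma binForm_isHomogeneous (n : ℕ) (v : Fin (n + 1) → ℂ) : (binForm n v).IsHomogeneous n := by
  rw [binForm_eq_sum_monomial]
  exact IsHomogeneous.sum _ _ _ fun i _ => isHomogeneous_monomial _
    ((binExp_eq_iff (Nat.lt_succ_iff.1 i.2)).1 rfl).1

lemma binForm_coeff {n : ℕ} {φ : MvPolynomial (Fin 2) ℂ} (h : φ.IsHomogeneous n) :
    binForm n (fun i : Fin (n + 1) => φ.coeff (binExp i (n - i))) = φ := by
  classical
  ext s
  rw [binForm_eq_sum_monomial, coeff_sum]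
  simp only [coeff_monomial]
  by_cases hs : s.degree = n
  · have h0 : s 0 < n + 1 := by
      have := Finsupp.le_degree 0 s
      omega
    rw [Finset.sum_eq_single_of_mem ⟨s 0, h0⟩ (Finset.mem_univ _)]
    · have := (binExp_eq_iff (s := s) (Nat.lt_succ_iff.1 h0)).2 ⟨hs, rfl⟩
      simp only
      rw [if_pos this, this]
    · intro i _ hi
      rw [if_neg]
      intro he
      exact hi (Fin.ext ((binExp_eq_iff (Nat.lt_succ_iff.1 i.2)).1 he).2.symm)
  · rw [h.coeff_eq_zero hs]
    refine Finset.sum_eq_zero fun i _ => if_neg fun he => hs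
      ((binExp_eq_iff (Nat.lt_succ_iff.1 i.2)).1 he).1

lemma binFormAct_eq_coeff (n : ℕ) (g : SL(2, ℂ)) (v : Fin (n + 1) → ℂ) :
    binFormAct n g v
      = fun i : Fin (n + 1) => (linSubst g (binForm n v)).coeff (binExp i (n - i)) := rfl

lemma binFormAct_binFormAct (n : ℕ) (g h : SL(2, ℂ)) (v : Fin (n + 1) → ℂ) :
    binFormAct n g (binFormAct n h v) = binFormAct n (h * g) v := by
  rw [binFormAct_eq_coeff n g, binFormAct_eq_coeff n h,
    binForm_coeff (linSubst_isHomogeneous h (binForm_isHomogeneous n v)), linSubst_linSubst,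
    binFormAct_eq_coeff]

lemma repAct_repAct {r : ℕ} {d : Fin r → ℕ} (g h : SL(2, ℂ))
    (v : (Σ k : Fin r, Fin (d k + 1)) → ℂ) :
    repAct r d g (repAct r d h v) = repAct r d (h * g) v := by
  funext p
  exact congrFun (binFormAct_binFormAct (d p.1) g h fun i => v ⟨p.1, i⟩) p.2

lemma coeff_binExp_eq {n i : ℕ} (hi : i ≤ n) {φ : MvPolynomial (Fin 2) ℂ}
    (h : φ.IsHomogeneous n) :
    φ.coeff (binExp i (n - i)) = (aeval ![Polynomial.X, (1 : Polynomial ℂ)] φ).coeff i := by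
  classical
  conv_rhs => rw [φ.as_sum]
  rw [map_sum, Polynomial.finsetSum_coeff]
  simp only [aeval_monomial, Finsupp.prod_fintype _ _ fun _ => pow_zero _, Fin.prod_univ_two,
    Matrix.cons_val_zero, Matrix.cons_val_one, one_pow, mul_one, Polynomial.algebraMap_apply,
    Algebra.algebraMap_self, RingHom.id_apply, Polynomial.coeff_C_mul, Polynomial.coeff_X_pow]
  by_cases hm : binExp i (n - i) ∈ φ.support
  · rw [Finset.sum_eq_single_of_mem _ hm]
    · rw [if_pos ((binExp_eq_iff hi).1 rfl).2.symm, mul_one]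
    · intro s hs hne
      rw [if_neg, mul_zero]
      intro h0
      exact hne ((binExp_eq_iff hi).2 ⟨by
        by_contra hdeg
        exact (mem_support_iff.1 hs) (h.coeff_eq_zero hdeg), h0.symm⟩).symm
  · rw [notMem_support_iff.1 hm]
    refine (Finset.sum_eq_zero fun s hs => ?_).symm
    rw [if_neg, mul_zero]
    intro h0
    refine hm ?_
    rwa [(binExp_eq_iff hi).2 ⟨by
        by_contra hdeg
        exact (mem_support_iff.1 hs) (h.coeff_eq_zero hdeg), h0.symm⟩]

lemma binFormAct_apply (n : ℕ) (g : SL(2, ℂ)) (v : Fin (n + 1) → ℂ) (i : Fin (n + 1)) :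
    binFormAct n g v i = ∑ j : Fin (n + 1), v j *
      ((Polynomial.C (g 0 0) * Polynomial.X + Polynomial.C (g 0 1)) ^ (j : ℕ)
        * (Polynomial.C (g 1 0) * Polynomial.X + Polynomial.C (g 1 1)) ^ (n - j)).coeff i := by
  rw [binFormAct_eq_coeff]
  simp only
  rw [coeff_binExp_eq (Nat.lt_succ_iff.1 i.2) (linSubst_isHomogeneous g (binForm_isHomogeneous n v)),
    binForm, map_sum, map_sum, Polynomial.finsetSum_coeff]
  refine Finset.sum_congr rfl fun j _ => ?_
  rw [← Polynomial.coeff_C_mul]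
  congr 1
  simp [linSubst, Fin.sum_univ_two, mul_assoc]

/-- Upper triangular unipotent matrices. -/
def upperUnipotent (a : ℂ) : SL(2, ℂ) := ⟨!![1, a; 0, 1], by simp⟩

/-- Lower triangular unipotent matrices. -/
def lowerUnipotent (a : ℂ) : SL(2, ℂ) := ⟨!![1, 0; a, 1], by simp⟩

/-- Diagonal matrices. -/
def diagTorus (a : ℂ) (ha : a ≠ 0) : SL(2, ℂ) := ⟨!![a, 0; 0, a⁻¹], by simp [ha]⟩

lemma binFormAct_upperUnipotent (n : ℕ) (a : ℂ) (v : Fin (n + 1) → ℂ) (i : Fin (n + 1)) :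
    binFormAct n (upperUnipotent a) v i
      = ∑ j : Fin (n + 1), v j * ((j : ℕ).choose i * a ^ ((j : ℕ) - i)) := by
  rw [binFormAct_apply]
  refine Finset.sum_congr rfl fun j _ => ?_
  simp [upperUnipotent, Polynomial.coeff_X_add_C_pow, mul_comm]

lemma binFormAct_lowerUnipotent (n : ℕ) (a : ℂ) (v : Fin (n + 1) → ℂ) (i : Fin (n + 1)) :
    binFormAct n (lowerUnipotent a) v i
      = ∑ j : Fin (n + 1), v j * (if (j : ℕ) ≤ i then
          (n - (j : ℕ)).choose (i - j) * a ^ ((i : ℕ) - j) else 0) := by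
  rw [binFormAct_apply]
  refine Finset.sum_congr rfl fun j _ => ?_
  have : ∀ m k : ℕ, ((Polynomial.C a * Polynomial.X + 1) ^ m).coeff k = m.choose k * a ^ k := by
    intro m k
    have h1 : (Polynomial.C a * Polynomial.X + 1 : Polynomial ℂ) ^ m
        = ((Polynomial.X + 1) ^ m).comp (Polynomial.C a * Polynomial.X) := by simp
    rw [h1, Polynomial.comp_C_mul_X_coeff, Polynomial.coeff_X_add_one_pow]
  simp [lowerUnipotent, Polynomial.coeff_X_pow_mul', this]

lemma C_pow_mul_X_pow_mul_C_pow (a b : ℂ) (j k : ℕ) :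
    (Polynomial.C a * Polynomial.X) ^ j * Polynomial.C b ^ k
      = Polynomial.C (a ^ j * b ^ k) * Polynomial.X ^ j := by
  rw [mul_pow, map_mul, map_pow, map_pow]
  ring

lemma binFormAct_diagTorus (n : ℕ) {a : ℂ} (ha : a ≠ 0) (v : Fin (n + 1) → ℂ) (i : Fin (n + 1)) :
    binFormAct n (diagTorus a ha) v i = v i * a ^ (2 * (i : ℤ) - n) := by
  rw [binFormAct_apply, Finset.sum_eq_single_of_mem i (Finset.mem_univ i)]
  · have hi : (i : ℕ) ≤ n := Nat.lt_succ_iff.1 i.2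
    congr 1
    have : (2 * (i : ℤ) - n) = (i : ℕ) + -((n - i : ℕ) : ℤ) := by omega
    rw [this, zpow_add₀ ha, zpow_neg, zpow_natCast, zpow_natCast]
    simp [diagTorus, C_pow_mul_X_pow_mul_C_pow, -map_pow, -map_mul, Polynomial.coeff_C_mul,
      Polynomial.coeff_X_pow]
  · intro j _ hj
    have : (i : ℕ) ≠ j := fun h => hj (Fin.ext h.symm)
    simp [diagTorus, C_pow_mul_X_pow_mul_C_pow, -map_pow, -map_mul, Polynomial.coeff_C_mul,
      Polynomial.coeff_X_pow, this]

lemma mul_entry (g h : SL(2, ℂ)) (i j : Fin 2) : (g * h) i j = g i 0 * h 0 j + g i 1 * h 1 j :=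
  (Matrix.mul_apply ..).trans (Fin.sum_univ_two _)

lemma upperUnipotent_entry (a : ℂ) (i j : Fin 2) :
    upperUnipotent a i j = !![1, a; 0, 1] i j := rfl

lemma lowerUnipotent_entry (a : ℂ) (i j : Fin 2) :
    lowerUnipotent a i j = !![1, 0; a, 1] i j := rfl

lemma unipotent_induction {P : SL(2, ℂ) → Prop} (hmul : ∀ g h, P g → P h → P (g * h))
    (hu : ∀ a, P (upperUnipotent a)) (hl : ∀ a, P (lowerUnipotent a)) (g : SL(2, ℂ)) : P g := by
  have key : ∀ g : SL(2, ℂ), g 1 0 ≠ 0 → P g := by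
    intro g hg
    have hdet := g.det_coe
    rw [Matrix.det_fin_two] at hdet
    have : g = upperUnipotent ((g 0 0 - 1) / g 1 0) * lowerUnipotent (g 1 0)
        * upperUnipotent ((g 1 1 - 1) / g 1 0) := by
      ext i j
      fin_cases i <;> fin_cases j <;>
        simp [upperUnipotent_entry, lowerUnipotent_entry, mul_entry] <;> field_simp <;>
        first | ring1 | linear_combination -hdet
    rw [this]
    exact hmul _ _ (hmul _ _ (hu _) (hl _)) (hu _)
  by_cases hg : g 1 0 = 0
  · have hdet := g.det_coe
    rw [Matrix.det_fin_two, hg] at hdet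
    have h1 : g = g * lowerUnipotent 1 * lowerUnipotent (-1) := by
      ext i j
      fin_cases i <;> fin_cases j <;>
        simp [lowerUnipotent_entry, mul_entry]
    rw [h1]
    refine hmul _ _ (key _ ?_) (hl _)
    have h2 : g 1 1 ≠ 0 := by
      intro h
      rw [h] at hdet
      simp at hdet
    simpa [lowerUnipotent_entry, mul_entry, hg] using h2
  · exact key g hg

end Action
section Derivations
open MvPolynomial

variable {r : ℕ} (d : Fin r → ℕ)

/-- The weight of a coordinate under the diagonal torus. -/
def wt (p : Σ k : Fin r, Fin (d k + 1)) : ℤ := 2 * ((p.2 : ℕ) : ℤ) - d p.1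

/-- The coordinate functions, extended by zero to all integer indices. -/
def coordVar (k : Fin r) (j : ℤ) : MvPolynomial (Σ k : Fin r, Fin (d k + 1)) ℂ :=
  if h : 0 ≤ j ∧ j ≤ d k then X ⟨k, ⟨j.toNat, by omega⟩⟩ else 0

lemma coordVar_coe (p : Σ k : Fin r, Fin (d k + 1)) :
    coordVar d p.1 ((p.2 : ℕ) : ℤ) = X p := by
  rw [coordVar, dif_pos ⟨by omega, by have := p.2.2; omega⟩]
  rfl

lemma coordVar_eq_zero {k : Fin r} {j : ℤ} (h : j < 0 ∨ (d k : ℤ) < j) : coordVar d k j = 0 :=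
  dif_neg (by omega)

lemma exists_coordVar {k : Fin r} {j : ℤ} (h : 0 ≤ j ∧ j ≤ d k) :
    ∃ i : Fin (d k + 1), ((i : ℕ) : ℤ) = j :=
  ⟨⟨j.toNat, by omega⟩, by simpa using h.1⟩

/-- The raising operator. -/
def raise : Derivation ℂ (MvPolynomial (Σ k : Fin r, Fin (d k + 1)) ℂ)
    (MvPolynomial (Σ k : Fin r, Fin (d k + 1)) ℂ) :=
  mkDerivation ℂ fun p => (((p.2 : ℕ) : ℂ) + 1) • coordVar d p.1 (((p.2 : ℕ) : ℤ) + 1)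

/-- The lowering operator. -/
def lower : Derivation ℂ (MvPolynomial (Σ k : Fin r, Fin (d k + 1)) ℂ)
    (MvPolynomial (Σ k : Fin r, Fin (d k + 1)) ℂ) :=
  mkDerivation ℂ fun p =>
    ((d p.1 : ℂ) - ((p.2 : ℕ) : ℂ) + 1) • coordVar d p.1 (((p.2 : ℕ) : ℤ) - 1)

lemma raise_coordVar (k : Fin r) (j : ℤ) :
    raise d (coordVar d k j) = ((j : ℂ) + 1) • coordVar d k (j + 1) := by
  by_cases h : 0 ≤ j ∧ j ≤ d k
  · obtain ⟨i, rfl⟩ := exists_coordVar d h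
    rw [coordVar_coe d ⟨k, i⟩, raise, mkDerivation_X]
    simp
  · rw [coordVar_eq_zero d (by omega), map_zero]
    by_cases hj : j = -1
    · simp [hj]
    · rw [coordVar_eq_zero d (by omega), smul_zero]

lemma lower_coordVar (k : Fin r) (j : ℤ) :
    lower d (coordVar d k j) = ((d k : ℂ) - j + 1) • coordVar d k (j - 1) := by
  by_cases h : 0 ≤ j ∧ j ≤ d k
  · obtain ⟨i, rfl⟩ := exists_coordVar d h
    rw [coordVar_coe d ⟨k, i⟩, lower, mkDerivation_X]
    simp
  · rw [coordVar_eq_zero d (by omega), map_zero]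
    by_cases hj : j = d k + 1
    · simp [hj]
    · rw [coordVar_eq_zero d (by omega), smul_zero]

lemma commutator_raise_lower :
    ⁅raise d, lower d⁆ = mkDerivation ℂ fun p => (wt d p : ℂ) • (X p : MvPolynomial _ ℂ) := by
  refine derivation_ext fun p => ?_
  rw [Derivation.commutator_apply, mkDerivation_X, ← coordVar_coe, raise_coordVar, lower_coordVar,
    Derivation.map_smul, Derivation.map_smul, raise_coordVar, lower_coordVar, smul_smul, smul_smul, sub_add_cancel,
    add_sub_cancel_right, ← sub_smul]
  congr 1
  simp only [wt]
  push_cast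
  ring

end Derivations

section WeightedDerivation
open MvPolynomial

variable {σ R M : Type*} [CommSemiring R] [AddCommMonoid M]

lemma isWeightedHomogeneous_mkDerivation {w : σ → M} {g : σ → MvPolynomial σ R} {δ : M}
    (hg : ∀ p, (g p).IsWeightedHomogeneous w (w p + δ)) {m : M} {f : MvPolynomial σ R}
    (hf : f.IsWeightedHomogeneous w m) :
    (mkDerivation R g f).IsWeightedHomogeneous w (m + δ) := by
  rw [f.as_sum, map_sum]
  refine IsWeightedHomogeneous.sum _ _ _ fun s hs => ?_
  rw [mkDerivation_monomial]
  refine (weightedHomogeneousSubmodule R w _).smul_mem _ ?_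
  refine IsWeightedHomogeneous.sum _ _ _ fun i hi => ?_
  have hle : Finsupp.single i 1 ≤ s := by
    rw [Finsupp.single_le_iff]
    exact Nat.one_le_iff_ne_zero.2 (Finsupp.mem_support_iff.1 hi)
  have h1 : m + δ = Finsupp.weight w (s - Finsupp.single i 1) + (w i + δ) := by
    rw [← hf (mem_support_iff.1 hs), ← add_assoc]
    conv_lhs => rw [← tsub_add_cancel_of_le hle]
    rw [map_add, Finsupp.weight_single, one_smul]
  rw [h1]
  exact (isWeightedHomogeneous_monomial _ _ _ rfl).mul (hg i)

lemma mkDerivation_smul_X_eq {σ R : Type*} [CommRing R] {w : σ → ℤ} {c : ℤ} {f : MvPolynomial σ R}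
    (hf : f.IsWeightedHomogeneous w c) :
    mkDerivation R (fun p => (w p : R) • (X p : MvPolynomial σ R)) f = (c : R) • f := by
  conv_rhs => rw [f.as_sum]
  conv_lhs => rw [f.as_sum]
  rw [map_sum, Finset.smul_sum]
  refine Finset.sum_congr rfl fun s hs => ?_
  rw [mkDerivation_monomial, ← hf (mem_support_iff.1 hs), Finsupp.weight_apply,
    Finsupp.sum, Finsupp.sum]
  have h1 : ∀ i ∈ s.support, (monomial (s - Finsupp.single i 1) ((s i : ℕ) : R)) •
      ((w i : R) • (X i : MvPolynomial σ R)) = ((s i • w i : ℤ) : R) • monomial s 1 := by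
    intro i hi
    have hle : Finsupp.single i 1 ≤ s := by
      rw [Finsupp.single_le_iff]
      exact Nat.one_le_iff_ne_zero.2 (Finsupp.mem_support_iff.1 hi)
    rw [smul_eq_mul, mul_smul_comm, X, monomial_mul, tsub_add_cancel_of_le hle, smul_monomial,
      smul_monomial]
    simp [mul_comm]
  rw [Finset.sum_congr rfl h1, ← Finset.sum_smul, smul_comm, smul_monomial, smul_eq_mul, mul_one, Int.cast_sum]

end WeightedDerivation
section WeightSpace
open MvPolynomial

variable {r : ℕ} (d : Fin r → ℕ)

/-- The exponents of the monomials of degree `n` and weight `c`. -/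
def weightExps (n : ℕ) (c : ℤ) : Finset ((Σ k : Fin r, Fin (d k + 1)) →₀ ℕ) :=
  (Finset.finsuppAntidiag Finset.univ n).filter fun s => Finsupp.weight (wt d) s = c

lemma mem_weightExps {n : ℕ} {c : ℤ} {s : (Σ k : Fin r, Fin (d k + 1)) →₀ ℕ} :
    s ∈ weightExps d n c ↔ s.degree = n ∧ Finsupp.weight (wt d) s = c := by
  rw [weightExps, Finset.mem_filter, Finset.mem_finsuppAntidiag, Finsupp.degree_eq_sum]
  simp

/-- The polynomials of degree `n` and weight `c`. -/
def weightSpace (n : ℕ) (c : ℤ) : Submodule ℂ (MvPolynomial (Σ k : Fin r, Fin (d k + 1)) ℂ) :=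
  restrictSupport ℂ (weightExps d n c)

/-- The basis of monomials of a weight space. -/
def weightBasis (n : ℕ) (c : ℤ) :
    Module.Basis (weightExps d n c : Set ((Σ k : Fin r, Fin (d k + 1)) →₀ ℕ)) ℂ
      (weightSpace d n c) :=
  basisRestrictSupport ℂ _

instance (n : ℕ) (c : ℤ) : Module.Finite ℂ (weightSpace d n c) :=
  Module.Finite.of_basis (weightBasis d n c)

lemma finrank_weightSpace (n : ℕ) (c : ℤ) :
    Module.finrank ℂ (weightSpace d n c) = (weightExps d n c).card := by
  rw [Module.finrank_eq_nat_card_basis (weightBasis d n c)]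
  simp

lemma mem_weightSpace {n : ℕ} {c : ℤ} {f : MvPolynomial (Σ k : Fin r, Fin (d k + 1)) ℂ} :
    f ∈ weightSpace d n c ↔ f.IsHomogeneous n ∧ f.IsWeightedHomogeneous (wt d) c := by
  rw [weightSpace, mem_restrictSupport_iff]
  constructor
  · refine fun h => ⟨fun s hs => ?_, fun s hs => ?_⟩
    · have hdeg := ((mem_weightExps d).1 (h (mem_support_iff.2 hs))).1
      rwa [Finsupp.degree_eq_weight_one] at hdeg
    · exact ((mem_weightExps d).1 (h (mem_support_iff.2 hs))).2
  · rintro ⟨h1, h2⟩ s hs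
    refine (mem_weightExps d).2 ⟨?_, h2 (mem_support_iff.1 hs)⟩
    rw [Finsupp.degree_eq_weight_one]
    exact h1 (mem_support_iff.1 hs)

lemma coordVar_isHomogeneous (k : Fin r) (j : ℤ) : (coordVar d k j).IsHomogeneous 1 := by
  unfold coordVar
  split_ifs
  · exact isHomogeneous_X _ _
  · exact isHomogeneous_zero _ _ _

lemma coordVar_isWeightedHomogeneous (k : Fin r) (j : ℤ) :
    (coordVar d k j).IsWeightedHomogeneous (wt d) (2 * j - d k) := by
  unfold coordVar
  split_ifs with h
  · have : 2 * j - d k = wt d ⟨k, ⟨j.toNat, by omega⟩⟩ := by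
      simp only [wt]
      omega
    rw [this]
    exact isWeightedHomogeneous_X _ _ _
  · exact isWeightedHomogeneous_zero _ _ _

lemma raise_mem {n : ℕ} {c : ℤ} {f : MvPolynomial (Σ k : Fin r, Fin (d k + 1)) ℂ}
    (hf : f ∈ weightSpace d n c) : raise d f ∈ weightSpace d n (c + 2) := by
  rw [mem_weightSpace] at hf ⊢
  constructor
  · refine isWeightedHomogeneous_mkDerivation (δ := 0) (fun p => ?_) hf.1
    exact (weightedHomogeneousSubmodule ℂ _ _).smul_mem _ (coordVar_isHomogeneous d _ _)
  · refine isWeightedHomogeneous_mkDerivation (δ := 2) (fun p => ?_) hf.2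
    refine (weightedHomogeneousSubmodule ℂ _ _).smul_mem _ ?_
    have : wt d p + 2 = 2 * (((p.2 : ℕ) : ℤ) + 1) - d p.1 := by rw [wt]; ring
    rw [this]
    exact coordVar_isWeightedHomogeneous d _ _

lemma lower_mem {n : ℕ} {c : ℤ} {f : MvPolynomial (Σ k : Fin r, Fin (d k + 1)) ℂ}
    (hf : f ∈ weightSpace d n c) : lower d f ∈ weightSpace d n (c - 2) := by
  rw [mem_weightSpace] at hf ⊢
  constructor
  · refine isWeightedHomogeneous_mkDerivation (δ := 0) (fun p => ?_) hf.1
    exact (weightedHomogeneousSubmodule ℂ _ _).smul_mem _ (coordVar_isHomogeneous d _ _)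
  · refine isWeightedHomogeneous_mkDerivation (δ := -2) (fun p => ?_) hf.2
    refine (weightedHomogeneousSubmodule ℂ _ _).smul_mem _ ?_
    have : wt d p + -2 = 2 * (((p.2 : ℕ) : ℤ) - 1) - d p.1 := by rw [wt]; ring
    rw [this]
    exact coordVar_isWeightedHomogeneous d _ _

lemma raise_lower_sub {n : ℕ} {c : ℤ} {f : MvPolynomial (Σ k : Fin r, Fin (d k + 1)) ℂ}
    (hf : f ∈ weightSpace d n c) : raise d (lower d f) - lower d (raise d f) = (c : ℂ) • f := by
  rw [← Derivation.commutator_apply, commutator_raise_lower]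
  exact mkDerivation_smul_X_eq ((mem_weightSpace d).1 hf).2

lemma abs_wt_le (p : Σ k : Fin r, Fin (d k + 1)) : |wt d p| ≤ ((∑ k, d k : ℕ) : ℤ) := by
  have h1 : d p.1 ≤ ∑ k, d k := Finset.single_le_sum (fun _ _ => Nat.zero_le _) (Finset.mem_univ _)
  have h2 := p.2.2
  rw [wt, abs_le]
  constructor <;> omega

lemma weightSpace_eq_bot {n : ℕ} {c : ℤ} (h : (n : ℤ) * (∑ k, d k : ℕ) < |c|) :
    weightSpace d n c = ⊥ := by
  have : weightExps d n c = ∅ := by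
    refine Finset.eq_empty_of_forall_notMem fun s hs => h.not_ge ?_
    obtain ⟨rfl, rfl⟩ := (mem_weightExps d).1 hs
    rw [Finsupp.weight_apply, Finsupp.sum, Finsupp.degree_apply]
    push_cast
    rw [Finset.sum_mul]
    refine (Finset.abs_sum_le_sum_abs _ _).trans (Finset.sum_le_sum fun p _ => ?_)
    rw [nsmul_eq_mul, abs_mul, Nat.abs_cast]
    gcongr
    exact_mod_cast abs_wt_le d p
  rw [weightSpace, this, restrictSupport_eq_span]
  simp

end WeightSpace

section OneParameter
open MvPolynomial

variable {r : ℕ} (d : Fin r → ℕ)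

lemma derivative_aeval {σ : Type*} {D : Derivation ℂ (MvPolynomial σ ℂ) (MvPolynomial σ ℂ)}
    {q : σ → Polynomial ℂ} (h : ∀ p, Polynomial.derivative (q p) = aeval q (D (X p)))
    (f : MvPolynomial σ ℂ) : Polynomial.derivative (aeval q f) = aeval q (D f) := by
  induction f using MvPolynomial.induction_on with
  | C a => simp [derivation_C]
  | add f g hf hg => simp [hf, hg]
  | mul_X f p hf =>
    rw [map_mul, Polynomial.derivative_mul, hf, aeval_X, h, Derivation.leibniz]
    simp
    ring

lemma derivation_eq_zero_iff {σ : Type*}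
    {D : Derivation ℂ (MvPolynomial σ ℂ) (MvPolynomial σ ℂ)}
    {q : (σ → ℂ) → σ → Polynomial ℂ}
    (h : ∀ v p, Polynomial.derivative (q v p) = aeval (q v) (D (X p)))
    (h0 : ∀ v p, (q v p).eval 0 = v p) (f : MvPolynomial σ ℂ) :
    D f = 0 ↔ ∀ a v, aeval (fun p => (q v p).eval a) f = aeval v f := by
  have heval (a : ℂ) (v : σ → ℂ) (f : MvPolynomial σ ℂ) :
      (aeval (q v) f).eval a = aeval (fun p => (q v p).eval a) f := by
    have := comp_aeval_apply (R := ℂ) (q v) (Polynomial.aeval a) f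
    simpa [Polynomial.coe_aeval_eq_eval] using this
  have heval0 (v : σ → ℂ) (f : MvPolynomial σ ℂ) : (aeval (q v) f).eval 0 = aeval v f := by
    rw [heval, funext (h0 v)]
  constructor
  · intro hD a v
    have h1 := derivative_aeval (h v) f
    rw [hD, map_zero] at h1
    rw [← heval, ← heval0, Polynomial.eq_C_of_derivative_eq_zero h1]
    simp
  · intro hinv
    refine MvPolynomial.funext fun v => ?_
    have h1 : aeval (q v) f = Polynomial.C (aeval v f) := Polynomial.funext fun a => by
      rw [heval, hinv, Polynomial.eval_C]
    have h2 := derivative_aeval (h v) f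
    rw [h1, Polynomial.derivative_C] at h2
    rw [map_zero, ← coe_aeval_eq_eval]
    refine (heval0 v (D f)).symm.trans ?_
    rw [← h2, Polynomial.eval_zero]

/-- The orbit of `v` under the upper unipotent one-parameter group. -/
def upperPath (v : (Σ k : Fin r, Fin (d k + 1)) → ℂ) (p : Σ k : Fin r, Fin (d k + 1)) :
    Polynomial ℂ :=
  ∑ j : Fin (d p.1 + 1), Polynomial.C (v ⟨p.1, j⟩) *
    (Polynomial.C (((j : ℕ).choose p.2 : ℕ) : ℂ) * Polynomial.X ^ ((j : ℕ) - p.2))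

/-- The orbit of `v` under the lower unipotent one-parameter group. -/
def lowerPath (v : (Σ k : Fin r, Fin (d k + 1)) → ℂ) (p : Σ k : Fin r, Fin (d k + 1)) :
    Polynomial ℂ :=
  ∑ j : Fin (d p.1 + 1), Polynomial.C (v ⟨p.1, j⟩) *
    if (j : ℕ) ≤ p.2 then Polynomial.C (((d p.1 - (j : ℕ)).choose (p.2 - j) : ℕ) : ℂ)
      * Polynomial.X ^ ((p.2 : ℕ) - j) else 0

lemma upperPath_eval (a : ℂ) (v : (Σ k : Fin r, Fin (d k + 1)) → ℂ) :
    (fun p => (upperPath d v p).eval a) = repAct r d (upperUnipotent a) v := by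
  funext p
  rw [repAct, binFormAct_upperUnipotent, upperPath, Polynomial.eval_finsetSum]
  simp

lemma lowerPath_eval (a : ℂ) (v : (Σ k : Fin r, Fin (d k + 1)) → ℂ) :
    (fun p => (lowerPath d v p).eval a) = repAct r d (lowerUnipotent a) v := by
  funext p
  rw [repAct, binFormAct_lowerUnipotent, lowerPath, Polynomial.eval_finsetSum]
  refine Finset.sum_congr rfl fun j _ => ?_
  split_ifs <;> simp

lemma repAct_diagTorus {a : ℂ} (ha : a ≠ 0) (v : (Σ k : Fin r, Fin (d k + 1)) → ℂ) :
    repAct r d (diagTorus a ha) v = fun p => v p * a ^ wt d p := by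
  funext p
  rw [repAct, binFormAct_diagTorus]
  rfl

lemma repAct_one (v : (Σ k : Fin r, Fin (d k + 1)) → ℂ) : repAct r d 1 v = v := by
  have : (1 : Matrix.SpecialLinearGroup (Fin 2) ℂ) = diagTorus 1 one_ne_zero := by
    ext i j
    fin_cases i <;> fin_cases j <;> simp [diagTorus]
  rw [this, repAct_diagTorus]
  simp

lemma upperUnipotent_zero : upperUnipotent 0 = 1 := by
  ext i j
  fin_cases i <;> fin_cases j <;> simp [upperUnipotent]

lemma lowerUnipotent_zero : lowerUnipotent 0 = 1 := by
  ext i j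
  fin_cases i <;> fin_cases j <;> simp [lowerUnipotent]

lemma aeval_upperPath_coordVar (v : (Σ k : Fin r, Fin (d k + 1)) → ℂ) (k : Fin r) (i : ℕ) :
    aeval (upperPath d v) (coordVar d k i) = ∑ j : Fin (d k + 1), Polynomial.C (v ⟨k, j⟩) *
      (Polynomial.C (((j : ℕ).choose i : ℕ) : ℂ) * Polynomial.X ^ ((j : ℕ) - i)) := by
  by_cases h : (i : ℤ) ≤ d k
  · obtain ⟨l, hl⟩ := exists_coordVar d ⟨Int.natCast_nonneg i, h⟩
    obtain rfl : (l : ℕ) = i := by exact_mod_cast hl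
    rw [coordVar_coe d ⟨k, l⟩, aeval_X]
    rfl
  · rw [coordVar_eq_zero d (by omega), map_zero]
    refine (Finset.sum_eq_zero fun j _ => ?_).symm
    rw [Nat.choose_eq_zero_of_lt (by omega)]
    simp

lemma derivative_upperPath (v : (Σ k : Fin r, Fin (d k + 1)) → ℂ)
    (p : Σ k : Fin r, Fin (d k + 1)) :
    Polynomial.derivative (upperPath d v p) = aeval (upperPath d v) (raise d (X p)) := by
  rw [← coordVar_coe, raise_coordVar, map_smul,
    show ((p.2 : ℕ) : ℤ) + 1 = ((p.2 + 1 : ℕ) : ℤ) by push_cast; rfl, aeval_upperPath_coordVar,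
    upperPath, Polynomial.derivative_sum, Finset.smul_sum]
  refine Finset.sum_congr rfl fun j _ => ?_
  have h := Nat.choose_succ_right_eq (j : ℕ) p.2
  rw [Polynomial.derivative_C_mul, Polynomial.derivative_C_mul, Polynomial.derivative_X_pow,
    ← mul_assoc (Polynomial.C ((_ : ℕ) : ℂ)), ← Polynomial.C_mul, ← Nat.cast_mul, ← h,
    Polynomial.smul_eq_C_mul, Nat.sub_sub]
  simp only [Nat.cast_mul, Polynomial.C_mul]
  push_cast
  ring

lemma derivative_lowerPath (v : (Σ k : Fin r, Fin (d k + 1)) → ℂ)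
    (p : Σ k : Fin r, Fin (d k + 1)) :
    Polynomial.derivative (lowerPath d v p) = aeval (lowerPath d v) (lower d (X p)) := by
  obtain ⟨k, ⟨i, hi⟩⟩ := p
  rw [← coordVar_coe, lower_coordVar, map_smul, lowerPath, Polynomial.derivative_sum]
  rcases i with _ | i
  · rw [coordVar_eq_zero d (by simp), map_zero, smul_zero]
    refine Finset.sum_eq_zero fun j _ => ?_
    by_cases hj : (j : ℕ) = 0 <;> simp [hj]
  · have h1 : ((i + 1 : ℕ) : ℤ) - 1 = ((⟨i, by omega⟩ : Fin (d k + 1)) : ℕ) := by simp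
    simp only [h1]
    rw [coordVar_coe d ⟨k, ⟨i, by omega⟩⟩, aeval_X, lowerPath, Finset.smul_sum]
    refine Finset.sum_congr rfl fun j _ => ?_
    simp only
    rw [Polynomial.derivative_C_mul, ← mul_smul_comm]
    congr 1
    by_cases hj : (j : ℕ) ≤ i
    · rw [if_pos hj, if_pos (by omega), Polynomial.derivative_C_mul, Polynomial.derivative_X_pow,
        ← mul_assoc, ← Polynomial.C_mul, Polynomial.smul_eq_C_mul, ← mul_assoc, ← Polynomial.C_mul]
      have h := Nat.choose_succ_right_eq (d k - j) (i - j)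
      have h2 : i + 1 - (j : ℕ) = i - j + 1 := by omega
      have h3 : d k - (j : ℕ) - (i - j) = d k - i := by omega
      rw [h2, Nat.add_sub_cancel, ← Nat.cast_mul, h, h3]
      congr 2
      push_cast [Nat.cast_sub (show i ≤ d k by omega)]
      ring
    · rw [if_neg hj, smul_zero]
      by_cases hj' : (j : ℕ) = i + 1
      · simp [hj']
      · rw [if_neg (by omega), Polynomial.derivative_zero]

lemma raise_eq_zero_iff (f : MvPolynomial (Σ k : Fin r, Fin (d k + 1)) ℂ) :
    raise d f = 0 ↔ ∀ a v, aeval (repAct r d (upperUnipotent a) v) f = aeval v f := by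
  rw [derivation_eq_zero_iff (derivative_upperPath d) fun v p => ?_]
  · simp only [upperPath_eval]
  · rw [congrFun (upperPath_eval d 0 v) p, upperUnipotent_zero, repAct_one]

lemma lower_eq_zero_iff (f : MvPolynomial (Σ k : Fin r, Fin (d k + 1)) ℂ) :
    lower d f = 0 ↔ ∀ a v, aeval (repAct r d (lowerUnipotent a) v) f = aeval v f := by
  rw [derivation_eq_zero_iff (derivative_lowerPath d) fun v p => ?_]
  · simp only [lowerPath_eval]
  · rw [congrFun (lowerPath_eval d 0 v) p, lowerUnipotent_zero, repAct_one]

lemma coeff_aeval_C_mul_X {σ : Type*} (u : σ → ℂ) (f : MvPolynomial σ ℂ) (s : σ →₀ ℕ) :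
    coeff s (aeval (fun p => C (u p) * X p) f) = coeff s f * s.prod fun p k => u p ^ k := by
  classical
  induction f using MvPolynomial.induction_on' with
  | monomial t a =>
    have : aeval (fun p => C (u p) * X p) (monomial t a)
        = monomial t (a * t.prod fun p k => u p ^ k) := by
      rw [aeval_monomial, algebraMap_eq, monomial_eq, C_mul, mul_assoc]
      congr 1
      simp only [mul_pow, Finsupp.prod_mul]
      congr 1
      simp [Finsupp.prod]
    rw [this, coeff_monomial, coeff_monomial]
    split_ifs with h
    · rw [h]
    · rw [zero_mul]
  | add f g hf hg => rw [map_add, coeff_add, coeff_add, hf, hg, add_mul]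

lemma isWeightedHomogeneous_zero_of_diagTorus {f : MvPolynomial (Σ k : Fin r, Fin (d k + 1)) ℂ}
    (h : ∀ v, aeval (repAct r d (diagTorus 2 two_ne_zero) v) f = aeval v f) :
    f.IsWeightedHomogeneous (wt d) 0 := by
  have h1 : aeval (fun p => C ((2 : ℂ) ^ wt d p) * X p) f = f := by
    refine MvPolynomial.funext fun v => ?_
    rw [← coe_aeval_eq_eval, RingHom.coe_coe, comp_aeval_apply (R := ℂ) _ (aeval v)]
    refine Eq.trans ?_ (h v)
    rw [repAct_diagTorus]
    simp [mul_comm]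
  intro s hs
  have h2 := congrArg (coeff s) h1
  rw [coeff_aeval_C_mul_X] at h2
  have h3 : s.prod (fun p k => ((2 : ℂ) ^ wt d p) ^ k) = 2 ^ Finsupp.weight (wt d) s := by
    rw [Finsupp.weight_apply, Finsupp.sum, Finsupp.prod]
    induction s.support using Finset.induction_on with
    | empty => simp
    | insert p t hp ih =>
      rw [Finset.prod_insert hp, Finset.sum_insert hp, ih, zpow_add₀ two_ne_zero, nsmul_eq_mul,
        mul_comm _ (wt d p), zpow_mul, zpow_natCast]
  rw [h3] at h2
  have h4 : (2 : ℂ) ^ Finsupp.weight (wt d) s = 1 := mul_left_cancel₀ hs (h2.trans (mul_one _).symm)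
  have h5 : (2 : ℝ) ^ Finsupp.weight (wt d) s = 1 := by
    simpa using congrArg norm h4
  rwa [zpow_eq_one_iff_right₀ (by norm_num) (by norm_num)] at h5

lemma mem_invariantsDeg {n : ℕ} {f : MvPolynomial (Σ k : Fin r, Fin (d k + 1)) ℂ} :
    f ∈ invariantsDeg r d n ↔
      f.IsHomogeneous n ∧ ∀ g v, aeval (repAct r d g v) f = aeval v f := by
  simp [invariantsDeg, sub_eq_zero]

lemma invariantsDeg_eq (n : ℕ) :
    invariantsDeg r d n = weightSpace d n 0 ⊓ LinearMap.ker (raise d).toLinearMap := by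
  ext f
  rw [mem_invariantsDeg, Submodule.mem_inf, LinearMap.mem_ker, Derivation.coeFn_coe]
  constructor
  · rintro ⟨hn, hf⟩
    exact ⟨(mem_weightSpace d).2 ⟨hn, isWeightedHomogeneous_zero_of_diagTorus d fun v => hf _ v⟩,
      (raise_eq_zero_iff d f).2 fun a v => hf _ v⟩
  · rintro ⟨hf, hE⟩
    have hF : lower d f = 0 :=
      lower_eq_zero (E := (raise d).toLinearMap) (F := (lower d).toLinearMap)
        (W := weightSpace d n) (fun c g hg => lower_mem d hg) (fun c g hg => raise_lower_sub d hg)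
        (fun c hc => weightSpace_eq_bot d hc) hf hE
    refine ⟨((mem_weightSpace d).1 hf).1, fun g => ?_⟩
    induction g using unipotent_induction with
    | hmul g h hg hh => exact fun v => by rw [← repAct_repAct, hh, hg]
    | hu a => exact (raise_eq_zero_iff d f).1 hE a
    | hl a => exact (lower_eq_zero_iff d f).1 hF a

lemma finrank_inf_ker_add {A : Type*} [AddCommGroup A] [Module ℂ A] (E : A →ₗ[ℂ] A)
    (U W : Submodule ℂ A) [Module.Finite ℂ U] (hmem : ∀ f ∈ U, E f ∈ W)
    (hsurj : ∀ f ∈ W, ∃ u ∈ U, E u = f) :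
    Module.finrank ℂ ↥(U ⊓ LinearMap.ker E) + Module.finrank ℂ W = Module.finrank ℂ U := by
  have hrange : LinearMap.range (E.domRestrict U) = W := by
    rw [LinearMap.range_domRestrict]
    exact le_antisymm (Submodule.map_le_iff_le_comap.2 hmem) hsurj
  rw [← Submodule.map_comap_subtype, Submodule.finrank_map_subtype_eq, ← LinearMap.ker_domRestrict,
    ← hrange, add_comm]
  exact LinearMap.finrank_range_add_finrank_ker _

lemma hilbDim_add_card (n : ℕ) :
    hilbDim r d n + (weightExps d n 2).card = (weightExps d n 0).card := by
  rw [← finrank_weightSpace, ← finrank_weightSpace, hilbDim, invariantsDeg_eq]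
  refine finrank_inf_ker_add (raise d).toLinearMap _ _ (fun f hf => ?_) fun f hf => ?_
  · have h := raise_mem d hf
    rwa [zero_add] at h
  obtain ⟨u, hu, h⟩ := raise_surjective (E := (raise d).toLinearMap) (F := (lower d).toLinearMap)
    (W := weightSpace d n) (fun c g hg => raise_mem d hg) (fun c g hg => lower_mem d hg)
    (fun c g hg => raise_lower_sub d hg) (fun c hc => weightSpace_eq_bot d hc) two_pos f hf
  rw [sub_self] at hu
  exact ⟨u, hu, h⟩

end OneParameter
section HilbertSeries

variable {r : ℕ} (d : Fin r → ℕ)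

lemma hilbDim_cast (n : ℕ) :
    (hilbDim r d n : ℝ) = (weightExps d n 0).card - (weightExps d n 2).card := by
  rw [← hilbDim_add_card]
  push_cast
  ring

lemma hilbDim_zero : hilbDim r d 0 = 1 := by
  have h0 : weightExps d 0 0 = {0} := by
    ext s
    rw [mem_weightExps, Finset.mem_singleton, Finsupp.degree_eq_zero_iff]
    exact ⟨fun h => h.1, fun h => ⟨h, by simp [h]⟩⟩
  have h2 : weightExps d 0 2 = ∅ := by
    refine Finset.eq_empty_of_forall_notMem fun s hs => ?_
    rw [mem_weightExps, Finsupp.degree_eq_zero_iff] at hs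
    obtain ⟨rfl, h⟩ := hs
    simp at h
  simpa [h0, h2] using hilbDim_add_card d 0

lemma hilbDim_eq_zero (hr : r = 0) {n : ℕ} (hn : n ≠ 0) : hilbDim r d n = 0 := by
  subst hr
  have h0 : weightExps d n 0 = ∅ := by
    refine Finset.eq_empty_of_forall_notMem fun s hs => hn ?_
    rw [← ((mem_weightExps d).1 hs).1, Subsingleton.elim s 0, map_zero]
  have := hilbDim_add_card d n
  rw [h0, Finset.card_empty] at this
  omega

lemma hilbDim_le (n : ℕ) :
    hilbDim r d n ≤ (n + 1) ^ Fintype.card (Σ k : Fin r, Fin (d k + 1)) := by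
  refine ((Nat.le_add_right _ _).trans_eq (hilbDim_add_card d n)).trans ?_
  have : (Fintype.piFinset fun _ : (Σ k : Fin r, Fin (d k + 1)) => Finset.range (n + 1)).card
      = (n + 1) ^ Fintype.card (Σ k : Fin r, Fin (d k + 1)) := by simp
  rw [← this]
  refine Finset.card_le_card_of_injOn (fun s => ⇑s) (fun s hs => ?_)
    DFunLike.coe_injective.injOn
  have hs := ((mem_weightExps d).1 hs).1
  refine Fintype.mem_piFinset.2 fun p => ?_
  have := Finsupp.le_degree p s
  exact Finset.mem_range.2 (by change s p < n + 1; omega)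

lemma summable_hilbDim {t : ℝ} (ht : t ∈ Set.Ioo (0 : ℝ) 1) :
    Summable fun n => ‖(hilbDim r d n : ℝ) * t ^ n‖ := by
  set N := Fintype.card (Σ k : Fin r, Fin (d k + 1))
  have h1 : Summable fun n : ℕ => ((n + 1 : ℕ) : ℝ) ^ N * t ^ (n + 1) :=
    (summable_nat_add_iff (f := fun n : ℕ => (n : ℝ) ^ N * t ^ n) 1).2
      (summable_pow_mul_geometric_of_norm_lt_one N
        (by rw [Real.norm_of_nonneg ht.1.le]; exact ht.2))
  refine Summable.of_nonneg_of_le (fun _ => norm_nonneg _) (fun n => ?_) (h1.mul_left t⁻¹)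
  have h2 : (hilbDim r d n : ℝ) ≤ ((n + 1 : ℕ) : ℝ) ^ N := by exact_mod_cast hilbDim_le d n
  have ht0 := ht.1
  rw [Real.norm_of_nonneg (by positivity), pow_succ t]
  calc (hilbDim r d n : ℝ) * t ^ n ≤ ((n + 1 : ℕ) : ℝ) ^ N * t ^ n := by gcongr
    _ = t⁻¹ * (((n + 1 : ℕ) : ℝ) ^ N * (t ^ n * t)) := by field_simp

end HilbertSeries

section MolienSeries
open LaurentPolynomial
open scoped PowerSeries

variable {r : ℕ} (d : Fin r → ℕ)

lemma mk_T_mul_one_sub (w : ℤ) :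
    PowerSeries.mk (fun n => (T (w * n) : ℝ[T;T⁻¹])) * (1 - PowerSeries.C (T w) * PowerSeries.X)
      = 1 := by
  ext1 n
  rw [mul_sub, mul_one, ← mul_assoc, mul_comm _ (PowerSeries.C _), map_sub, PowerSeries.coeff_mk]
  rcases n with _ | n
  · simp
  · rw [PowerSeries.coeff_succ_mul_X, PowerSeries.coeff_C_mul, PowerSeries.coeff_mk, ← T_add,
      PowerSeries.coeff_one, if_neg n.succ_ne_zero, sub_eq_zero]
    congr 1
    push_cast
    ring

/-- The generating function of the dimensions of the weight spaces. -/
def molienSeries : ℝ[T;T⁻¹]⟦X⟧ :=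
  ∏ p : Σ k : Fin r, Fin (d k + 1), PowerSeries.mk fun n => T (wt d p * n)

lemma molienSeries_mul :
    molienSeries d * ∏ p : Σ k : Fin r, Fin (d k + 1),
      (1 - PowerSeries.C (T (wt d p)) * PowerSeries.X) = 1 := by
  rw [molienSeries, ← Finset.prod_mul_distrib]
  exact Finset.prod_eq_one fun p _ => mk_T_mul_one_sub _

lemma prod_T {ι : Type*} (s : Finset ι) (f : ι → ℤ) :
    ∏ i ∈ s, (T (f i) : ℝ[T;T⁻¹]) = T (∑ i ∈ s, f i) := by
  classical
  induction s using Finset.induction_on with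
  | empty => simp
  | insert i s hi ih => rw [Finset.prod_insert hi, Finset.sum_insert hi, ih, T_add]

lemma laurentCoeff_molienSeries (c : ℤ) :
    laurentCoeff c (molienSeries d) = PowerSeries.mk fun n => ((weightExps d n c).card : ℝ) := by
  ext n
  have h (l : (Σ k : Fin r, Fin (d k + 1)) →₀ ℕ) :
      ∑ p, wt d p * (l p : ℤ) = Finsupp.weight (wt d) l := by
    rw [Finsupp.weight_apply, Finsupp.sum_fintype l (fun p c => c • wt d p) fun _ => zero_smul ℕ _]
    exact Finset.sum_congr rfl fun p _ => by rw [nsmul_eq_mul, mul_comm]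
  rw [laurentCoeff, PowerSeries.coeff_mk, PowerSeries.coeff_mk, molienSeries,
    PowerSeries.coeff_prod]
  simp only [PowerSeries.coeff_mk, prod_T, h, AddMonoidAlgebra.coeff_sum, Finsupp.coe_finsetSum,
    Finset.sum_apply, T_apply]
  rw [weightExps, Finset.card_filter]
  push_cast
  rfl

/-- The involution of the coordinates that negates the weights. -/
def revCoord (p : Σ k : Fin r, Fin (d k + 1)) : Σ k : Fin r, Fin (d k + 1) := ⟨p.1, p.2.rev⟩

lemma revCoord_revCoord (p : Σ k : Fin r, Fin (d k + 1)) : revCoord d (revCoord d p) = p := by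
  simp [revCoord]

lemma wt_revCoord (p : Σ k : Fin r, Fin (d k + 1)) : wt d (revCoord d p) = -wt d p := by
  have := p.2.2
  simp only [wt, revCoord, Fin.val_rev]
  omega

/-- The coordinates of positive weight. -/
def posCoords : Finset (Σ k : Fin r, Fin (d k + 1)) := Finset.univ.filter fun p => 0 < wt d p

/-- The coordinates of weight zero. -/
def zeroCoords : Finset (Σ k : Fin r, Fin (d k + 1)) := Finset.univ.filter fun p => wt d p = 0

lemma prod_eq_pos_zero {M : Type*} [CommMonoid M] (f : ℤ → M) :
    ∏ p, f (wt d p) = (∏ p ∈ posCoords d, f (-wt d p)) * (∏ p ∈ posCoords d, f (wt d p))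
      * f 0 ^ (zeroCoords d).card := by
  have hneg : ∏ p ∈ posCoords d, f (-wt d p)
      = ∏ p ∈ Finset.univ.filter (fun p => wt d p < 0), f (wt d p) := by
    refine Finset.prod_nbij' (revCoord d) (revCoord d) ?_ ?_ ?_ ?_ ?_ <;>
      simp +contextual [posCoords, wt_revCoord, revCoord_revCoord]
  have hzero : f 0 ^ (zeroCoords d).card = ∏ p ∈ zeroCoords d, f (wt d p) := by
    rw [← Finset.prod_const]
    refine Finset.prod_congr rfl fun p hp => ?_
    rw [(Finset.mem_filter.1 hp).2]
  rw [hneg, hzero, ← Finset.prod_filter_mul_prod_filter_not Finset.univ (fun p => wt d p < 0),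
    ← Finset.prod_filter_mul_prod_filter_not (Finset.univ.filter fun p => ¬ wt d p < 0)
      (fun p => 0 < wt d p), Finset.filter_filter, Finset.filter_filter, mul_assoc]
  congr 2
  · refine Finset.prod_congr (Finset.filter_congr fun p _ => ?_) fun _ _ => rfl
    omega
  · refine Finset.prod_congr (Finset.filter_congr fun p _ => ?_) fun _ _ => rfl
    omega

lemma card_pos_zero : 2 * (posCoords d).card + (zeroCoords d).card = r + ∑ k, d k := by
  have h := prod_eq_pos_zero d (fun _ => Multiplicative.ofAdd 1)
  simp only [Finset.prod_const, ← ofAdd_nsmul, ← ofAdd_add] at h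
  have h := Multiplicative.ofAdd.injective h
  simp [Fintype.card_sigma, Finset.sum_add_distrib] at h
  omega

lemma sum_le_sum_posCoords : ∑ k, d k ≤ ∑ p ∈ posCoords d, (wt d p).toNat := by
  rw [posCoords, Finset.sum_filter_of_ne fun p _ h => by omega, Fintype.sum_sigma]
  refine Finset.sum_le_sum fun k _ => ?_
  calc d k = (wt d ⟨k, Fin.last _⟩).toNat := by simp [wt]; omega
    _ ≤ _ := Finset.single_le_sum (f := fun i => (wt d ⟨k, i⟩).toNat) (fun _ _ => Nat.zero_le _)
      (Finset.mem_univ _)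

lemma prod_posCoords_toNat {M : Type*} [CommMonoid M] (f : ℤ → M) :
    ∏ p ∈ posCoords d, f ((wt d p).toNat : ℤ) = ∏ p ∈ posCoords d, f (wt d p) :=
  Finset.prod_congr rfl fun _ hp => by
    rw [Int.toNat_of_nonneg (Finset.mem_filter.1 hp).2.le]

lemma molienSeries_mul_eq_one :
    molienSeries d *
      ((∏ p ∈ posCoords d, (1 - PowerSeries.C (T (-((wt d p).toNat : ℤ))) * PowerSeries.X)) *
      (∏ p ∈ posCoords d, (1 - PowerSeries.C (T ((wt d p).toNat : ℤ)) * PowerSeries.X)) *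
      (1 - PowerSeries.X) ^ (zeroCoords d).card) = 1 := by
  have h := molienSeries_mul d
  rw [prod_eq_pos_zero d fun w => 1 - PowerSeries.C (T w) * PowerSeries.X, T_zero, map_one,
    one_mul] at h
  rw [prod_posCoords_toNat d fun w => 1 - PowerSeries.C (T (-w)) * PowerSeries.X,
    prod_posCoords_toNat d fun w => 1 - PowerSeries.C (T w) * PowerSeries.X]
  exact h

end MolienSeries

lemma three_le_sum {r : ℕ} {d : Fin r → ℕ} (hr : r ≠ 0) (hd : ∀ k, 1 ≤ d k)
    (hne2V1 : Multiset.map d Finset.univ.val ≠ ({1, 1} : Multiset ℕ))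
    (hneVd : ∀ m : ℕ, m ≤ 4 → Multiset.map d Finset.univ.val ≠ ({m} : Multiset ℕ)) :
    3 ≤ ∑ k, d k := by
  rcases r with _ | _ | _ | r
  · exact absurd rfl hr
  · by_contra! h
    exact hneVd (d 0) (by simp at h; omega) (by simp)
  · by_contra! h
    rw [Fin.sum_univ_two] at h
    have h0 := hd 0
    have h1 := hd 1
    have h0' : d 0 = 1 := by omega
    have h1' : d 1 = 1 := by omega
    exact hne2V1 (by simp [Fin.univ_succ, h0', h1'])
  · calc 3 ≤ ∑ _k : Fin (r + 1 + 1 + 1), 1 := by simp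
      _ ≤ _ := Finset.sum_le_sum fun k _ => hd k

end SL2Hilbert

/-- **Corollary (a-invariant).** For `V = ⊕ₖ V_{d k}` with all `d k ≥ 1`, not isomorphic to
`2V₁` nor to `V_d` for `d ≤ 4`, the Hilbert series of `ℂ[V]^{SL₂}` is a rational function of
degree (numerator degree minus denominator degree) equal to `-D`. -/
theorem sl2_invariants_a_invariant
    (r : ℕ) (d : Fin r → ℕ) (hd : ∀ k, 1 ≤ d k)
    (hne2V1 : Multiset.map d Finset.univ.val ≠ ({1, 1} : Multiset ℕ))
    (hneVd : ∀ m : ℕ, m ≤ 4 → Multiset.map d Finset.univ.val ≠ ({m} : Multiset ℕ)) :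
    (∃ P Q : Polynomial ℝ, Q ≠ 0 ∧
      ∀ t ∈ Set.Ioo (0 : ℝ) 1, hilbFun r d t * Q.eval t = P.eval t) ∧
    ∀ P Q : Polynomial ℝ, Q ≠ 0 →
      (∀ t ∈ Set.Ioo (0 : ℝ) 1, hilbFun r d t * Q.eval t = P.eval t) →
      (P.natDegree : ℤ) - (Q.natDegree : ℤ) = -((r + ∑ k, d k : ℕ) : ℤ) := by
  have h0 : ((hilbDim r d 0 : ℕ) : ℝ) = 1 := by rw [SL2Hilbert.hilbDim_zero, Nat.cast_one]
  by_cases hr : r = 0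
  · have hD : r + ∑ k, d k = 0 := by
      subst hr
      simp
    rw [hD]
    refine SL2Hilbert.rational_of_mul_eq h0 (fun t ht => SL2Hilbert.summable_hilbDim d ht)
      SL2Hilbert.IsDenom.one (v := 1) ?_ one_ne_zero (fun t _ _ => by simp)
    ext n
    rcases n with _ | n
    · simp [h0]
    · simp [SL2Hilbert.hilbDim_eq_zero d hr n.succ_ne_zero, PowerSeries.coeff_one]
  · obtain ⟨v, B, hB, hv, h⟩ := SL2Hilbert.exists_rational_reciprocity (SL2Hilbert.posCoords d)
      (fun p => (SL2Hilbert.wt d p).toNat)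
      (fun p hp => by have := (Finset.mem_filter.1 hp).2; omega)
      ((SL2Hilbert.three_le_sum hr hd hne2V1 hneVd).trans (SL2Hilbert.sum_le_sum_posCoords d))
      (SL2Hilbert.zeroCoords d).card (SL2Hilbert.molienSeries_mul_eq_one d)
    rw [SL2Hilbert.card_pos_zero] at h
    refine SL2Hilbert.rational_of_mul_eq h0 (fun t ht => SL2Hilbert.summable_hilbDim d ht) hB ?_
      (neg_ne_zero.2 (pow_ne_zero _ (neg_ne_zero.2 one_ne_zero))) h
    rw [← hv, SL2Hilbert.laurentCoeff_molienSeries, SL2Hilbert.laurentCoeff_molienSeries]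
    congr 1
    ext n
    simp [SL2Hilbert.hilbDim_cast]

end
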